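/- Recursion for twisted traces: let p be a prime with Γ₀(p)* of genus zero, D > 1 and −d < 0 coprime fundamental discriminants congruent to squares mod 4p, l coprime to p, and k ≥ 0. Then t^{(p)}_{lp^{k+1}}(D,d) = 2·t^{(1)}_{lp^k}(D,d) − t^{(p)}_{lp^k}(D,d). -/

import Mathlib

open Complex

/-- The open upper half plane, as a subset of `ℂ`. -/
def UpperH : Set ℂ := {z : ℂ | 0 < z.im}

/-- Möbius action of an integral matrix of determinant one. -/
noncomputable def moebiusZ (g : Matrix.SpecialLinearGroup (Fin 2) ℤ) (z : ℂ) : ℂ :=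
  ((g.1 0 0 : ℂ) * z + (g.1 0 1 : ℂ)) / ((g.1 1 0 : ℂ) * z + (g.1 1 1 : ℂ))

/-- `g` has a `q`-expansion `q^{−m} + O(q)` (constant term `0`). -/
def HasPrincipalPart (m : ℕ) (g : ℂ → ℂ) : Prop :=
  ∃ a : ℕ → ℂ, ∀ τ ∈ UpperH,
    g τ = Complex.exp (-(2 * Real.pi * Complex.I * m * τ)) +
      ∑' n : ℕ, a n * Complex.exp (2 * Real.pi * Complex.I * (n + 1) * τ)

/-- `g` is invariant under `Γ₀(p)` and the Fricke involution `W_p`. -/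
def InvariantGamma0Star (p : ℕ) (g : ℂ → ℂ) : Prop :=
  (∀ γ ∈ CongruenceSubgroup.Gamma0 p, ∀ τ ∈ UpperH, g (moebiusZ γ τ) = g τ) ∧
    ∀ τ ∈ UpperH, g (-1 / (p * τ)) = g τ

/-- Subexponential-at-the-cusp-∞ growth: `g` is meromorphic at `∞`. -/
def MeromorphicAtInfty (g : ℂ → ℂ) : Prop :=
  ∃ C N : ℝ, ∀ τ ∈ UpperH, 1 ≤ τ.im → ‖g τ‖ ≤ C * Real.exp (2 * Real.pi * N * τ.im)

/-- `t` is a Hauptmodul for `Γ₀(p)*` (`p` prime), normalized `q⁻¹ + 0 + O(q)`: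
it is holomorphic, invariant, with the right principal part, and every invariant
meromorphic-at-cusps holomorphic function is a polynomial in `t`. -/
def IsHauptmodulStar (p : ℕ) (t : ℂ → ℂ) : Prop :=
  DifferentiableOn ℂ t UpperH ∧ InvariantGamma0Star p t ∧ HasPrincipalPart 1 t ∧
    ∀ g : ℂ → ℂ, DifferentiableOn ℂ g UpperH → InvariantGamma0Star p g →
      MeromorphicAtInfty g → ∃ P : Polynomial ℂ, ∀ τ ∈ UpperH,
        g τ = P.eval (t τ)

/-- `J` is a Hauptmodul for `SL₂(ℤ)` normalized `q⁻¹ + 0 + O(q)` (i.e. `j − 744`). -/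
def IsHauptmodulLevelOne (J : ℂ → ℂ) : Prop :=
  DifferentiableOn ℂ J UpperH ∧
    (∀ γ : Matrix.SpecialLinearGroup (Fin 2) ℤ, ∀ τ ∈ UpperH,
      J (moebiusZ γ τ) = J τ) ∧ HasPrincipalPart 1 J ∧
    ∀ g : ℂ → ℂ, DifferentiableOn ℂ g UpperH →
      (∀ γ : Matrix.SpecialLinearGroup (Fin 2) ℤ, ∀ τ ∈ UpperH,
        g (moebiusZ γ τ) = g τ) →
      MeromorphicAtInfty g → ∃ P : Polynomial ℂ, ∀ τ ∈ UpperH, g τ = P.eval (J τ)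

/-- An integral binary quadratic form `[a,b,c]`. -/
structure BQF where
  a : ℤ
  b : ℤ
  c : ℤ
deriving DecidableEq

def BQF.disc (Q : BQF) : ℤ := Q.b ^ 2 - 4 * Q.a * Q.c

def BQF.IsPosDef (Q : BQF) : Prop := 0 < Q.a ∧ Q.disc < 0

def BQF.act (Q : BQF) (g : Matrix.SpecialLinearGroup (Fin 2) ℤ) : BQF :=
  ⟨Q.a * (g.1 0 0) ^ 2 + Q.b * (g.1 0 0) * (g.1 1 0) + Q.c * (g.1 1 0) ^ 2,
   2 * Q.a * (g.1 0 0) * (g.1 0 1) + Q.b * ((g.1 0 0) * (g.1 1 1) + (g.1 0 1) * (g.1 1 0))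
     + 2 * Q.c * (g.1 1 0) * (g.1 1 1),
   Q.a * (g.1 0 1) ^ 2 + Q.b * (g.1 0 1) * (g.1 1 1) + Q.c * (g.1 1 1) ^ 2⟩

def BQF.mem (d : ℤ) (Q : BQF) : Prop := Q.IsPosDef ∧ Q.disc = -d

def BQF.memN (d : ℤ) (N : ℕ) (β : ℤ) (Q : BQF) : Prop :=
  Q.mem d ∧ (N : ℤ) ∣ Q.a ∧ Q.b ≡ β [ZMOD (2 * N)]

def BQF.equiv (G : Subgroup (Matrix.SpecialLinearGroup (Fin 2) ℤ)) (Q Q' : BQF) : Prop :=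
  ∃ g ∈ G, Q.act g = Q'

noncomputable def BQF.root (Q : BQF) : ℂ :=
  (-(Q.b : ℂ) + Complex.I * Real.sqrt (-(Q.disc : ℝ))) / (2 * Q.a)

def BQF.Represents (Q : BQF) (q : ℕ) : Prop :=
  ∃ x y : ℤ, Q.a * x ^ 2 + Q.b * x * y + Q.c * y ^ 2 = (q : ℤ)

def kroneckerAtTwo (a : ℤ) : ℤ :=
  if a % 2 = 0 then 0 else if a % 8 = 1 ∨ a % 8 = 7 then 1 else -1

def kronecker (a : ℤ) (n : ℕ) : ℤ :=
  if n = 0 then (if a = 1 ∨ a = -1 then 1 else 0)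
  else n.factorization.prod fun p k =>
    (if p = 2 then kroneckerAtTwo a else jacobiSym a p) ^ k

def IsFundamentalDiscriminant (D : ℤ) : Prop :=
  (D % 4 = 1 ∧ Squarefree D) ∨
    (D % 4 = 0 ∧ Squarefree (D / 4) ∧ ((D / 4) % 4 = 2 ∨ (D / 4) % 4 = 3))

section

open scoped ComplexOrder

open ArithmeticFunction in
/-- The twist `∑ g, ψ g • a g` of a family of arithmetic functions by a character. -/
noncomputable def charTwist {G : Type*} [AddCommGroup G] [Fintype G] (ψ : AddChar G ℂ)
    (a : G → ArithmeticFunction ℂ) : ArithmeticFunction ℂ :=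
  ⟨fun n => ∑ g, ψ g * a g n, by simp⟩

theorem charTwist_apply {G : Type*} [AddCommGroup G] [Fintype G] (ψ : AddChar G ℂ)
    (a : G → ArithmeticFunction ℂ) (n : ℕ) : charTwist ψ a n = ∑ g, ψ g * a g n := rfl

theorem charTwist_mul_log {G : Type*} [AddCommGroup G] [Fintype G] (ψ : AddChar G ℂ)
    {a lam : G → ArithmeticFunction ℂ}
    (h : ∀ g n, a g n * Real.log n = ∑ h, (a (g - h) * lam h) n) (n : ℕ) :
    charTwist ψ a n * Real.log n = (charTwist ψ a * charTwist ψ lam) n := by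
  simp only [charTwist_apply, ArithmeticFunction.mul_apply, Finset.sum_mul, mul_assoc, h]
  simp only [Finset.mul_sum]
  rw [Finset.sum_comm]
  conv_rhs => 
    rw [Finset.sum_congr rfl fun x _ => Finset.sum_comm]
    rw [Finset.sum_comm]
  refine Finset.sum_congr rfl fun k _ => ?_
  rw [← Equiv.sum_comp (Equiv.addRight k)]
  rw [Finset.sum_comm]
  refine Finset.sum_congr rfl fun x _ => Finset.sum_congr rfl fun g _ => ?_
  simp only [Equiv.coe_addRight, add_sub_cancel_right, AddChar.map_add_eq_mul]
  ring

theorem ArithmeticFunction.mul_mul_log (f g : ArithmeticFunction ℂ) (n : ℕ) :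
    (f * g) n * Real.log n =
      ∑ x ∈ n.divisorsAntidiagonal, (f x.1 * Real.log x.1) * g x.2 +
      ∑ x ∈ n.divisorsAntidiagonal, f x.1 * (g x.2 * Real.log x.2) := by
  rw [ArithmeticFunction.mul_apply, Finset.sum_mul, ← Finset.sum_add_distrib]
  refine Finset.sum_congr rfl fun x hx => ?_
  obtain ⟨hx, hn⟩ := Nat.mem_divisorsAntidiagonal.1 hx
  have h1 : (x.1 : ℝ) ≠ 0 := by rintro h; simp_all
  have h2 : (x.2 : ℝ) ≠ 0 := by rintro h; simp_all
  rw [← hx, Nat.cast_mul, Real.log_mul h1 h2]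
  push_cast
  ring

theorem ArithmeticFunction.prod_mul_log {ι : Type*} (s : Finset ι)
    (f l : ι → ArithmeticFunction ℂ)
    (h : ∀ i ∈ s, ∀ n : ℕ, f i n * Real.log n = (f i * l i) n) (n : ℕ) :
    (∏ i ∈ s, f i) n * Real.log n = ((∏ i ∈ s, f i) * ∑ i ∈ s, l i) n := by
  classical
  induction s using Finset.induction_on generalizing n with
  | empty =>
    by_cases hn : n = 1
    · simp [hn]
    · simp [ArithmeticFunction.one_apply_ne hn]
  | insert i s hi ih =>
    rw [Finset.prod_insert hi, Finset.sum_insert hi, ArithmeticFunction.mul_mul_log, mul_add,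
      ArithmeticFunction.add_apply]
    have ih' := ih fun j hj => h j (Finset.mem_insert_of_mem hj)
    simp only [ih', h i (Finset.mem_insert_self i s)]
    rw [← ArithmeticFunction.mul_apply, ← ArithmeticFunction.mul_apply]
    congr 2 <;> ring

/-- If the logarithmic derivative of `f` has nonnegative coefficients, then so does `f`. -/
theorem ArithmeticFunction.nonneg_of_mul_log {f l : ArithmeticFunction ℂ} (h1 : f 1 = 1)
    (h : ∀ n : ℕ, f n * Real.log n = (f * l) n) (hl : ∀ n, 0 ≤ l n) (n : ℕ) : 0 ≤ f n := by
  induction n using Nat.strong_induction_on with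
  | _ n ih =>
  rcases Nat.lt_or_ge n 2 with hn | hn
  · interval_cases n
    · simp
    · simp [h1]
  have hl1 : l 1 = 0 := by simpa [h1] using (h 1).symm
  have hpos : (0 : ℝ) < Real.log n := Real.log_pos (by exact_mod_cast hn)
  have hsum : 0 ≤ f n * (Real.log n : ℂ) := by
    rw [h, ArithmeticFunction.mul_apply]
    refine Finset.sum_nonneg fun x hx => ?_
    obtain ⟨hx, hn0⟩ := Nat.mem_divisorsAntidiagonal.1 hx
    by_cases hx2 : x.2 = 1
    · simp [hx2, hl1]
    · refine mul_nonneg (ih x.1 ?_) (hl _)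
      have : 0 < x.1 := Nat.pos_of_ne_zero (by rintro h; simp_all)
      have : x.2 ≠ 0 := by rintro h; simp_all
      have : 2 ≤ x.2 := by omega
      nlinarith
  have : f n = f n * (Real.log n : ℂ) * ((Real.log n)⁻¹ : ℝ) := by
    rw [mul_assoc, ← Complex.ofReal_mul, mul_inv_cancel₀ hpos.ne']; simp
  rw [this]
  refine mul_nonneg hsum ?_
  exact_mod_cast inv_nonneg.2 hpos.le

theorem ArithmeticFunction.LSeries_prod {ι : Type*} (s : Finset ι) (f : ι → ArithmeticFunction ℂ)
    {z : ℂ} (h : ∀ i ∈ s, LSeriesSummable (f i) z) :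
    LSeriesSummable (∏ i ∈ s, f i : ArithmeticFunction ℂ) z ∧
      LSeries (∏ i ∈ s, f i : ArithmeticFunction ℂ) z = ∏ i ∈ s, LSeries (f i) z := by
  classical
  induction s using Finset.induction_on with
  | empty =>
    simp only [Finset.prod_empty, ArithmeticFunction.one_eq_delta]
    refine ⟨?_, by simp [LSeries_delta]⟩
    simp only [LSeriesSummable, funext (LSeries.term_delta z)]
    exact (hasSum_ite_eq 1 1).summable
  | insert i s hi ih =>
    obtain ⟨h1, h2⟩ := ih fun j hj => h j (Finset.mem_insert_of_mem hj)
    rw [Finset.prod_insert hi, Finset.prod_insert hi]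
    exact ⟨ArithmeticFunction.LSeriesSummable_mul (h i (Finset.mem_insert_self i s)) h1, by
      rw [ArithmeticFunction.LSeries_mul' (h i (Finset.mem_insert_self i s)) h1, h2]⟩

end

section

open scoped ComplexOrder
open Filter Topology

theorem LSeries_deriv_eq_neg_mul {A l : ArithmeticFunction ℂ}
    (hA : ∀ s : ℂ, 1 < s.re → LSeriesSummable A s) (hl : ∀ s : ℂ, 1 < s.re → LSeriesSummable l s)
    (h : ∀ n : ℕ, A n * Real.log n = (A * l) n) {s : ℂ} (hs : 1 < s.re) :
    HasDerivAt (LSeries A) (-(LSeries A s * LSeries l s)) s := by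
  have habs : LSeries.abscissaOfAbsConv A < s.re := by
    refine (LSeries.abscissaOfAbsConv_le_of_forall_lt_LSeriesSummable (x := 1) fun y hy =>
      hA y (by simpa using hy)).trans_lt (by exact_mod_cast hs)
  have := LSeries_hasDerivAt habs
  rwa [show LSeries.logMul A = (fun n ↦ (A * l) n : ℕ → ℂ) from ?_,
    ArithmeticFunction.LSeries_mul' (hA s hs) (hl s hs)] at this
  funext n
  rw [← h, LSeries.logMul, mul_comm, Complex.natCast_log]

/-- Data of a family of partial zeta functions indexed by a finite abelian group `G`: `a g` are
the coefficients, `lam g` those of the corresponding von Mangoldt function, and `E g` is the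
entire part of the continuation. -/
structure PartialZetaData (G : Type*) [AddCommGroup G] [Fintype G] where
  a : G → ArithmeticFunction ℂ
  lam : G → ArithmeticFunction ℂ
  E : G → ℂ → ℂ
  κ : ℂ
  a_nonneg : ∀ g n, 0 ≤ a g n
  lam_nonneg : ∀ g n, 0 ≤ lam g n
  a_zero_one : a 0 1 = 1
  a_one : ∀ g, g ≠ 0 → a g 1 = 0
  mul_log : ∀ g n, a g n * Real.log n = ∑ h, (a (g - h) * lam h) n
  summable : ∀ g (s : ℂ), 1 < s.re → LSeriesSummable (a g) s
  differentiable_E : ∀ g, Differentiable ℂ (E g)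
  κ_ne_zero : κ ≠ 0
  LSeries_eq : ∀ g (s : ℂ), 1 < s.re → LSeries (a g) s = E g s + κ / (s - 1)
  E_neg_one : ∀ g, E g (-1) = κ / 2

namespace PartialZetaData

variable {G : Type*} [AddCommGroup G] [Fintype G] (Z : PartialZetaData G)

theorem norm_lam_le (g : G) (n : ℕ) : ‖Z.lam g n‖ ≤ ‖LSeries.logMul (Z.a g) n‖ := by
  rcases Nat.eq_zero_or_pos n with rfl | hn
  · simp
  have h1 : Z.lam g n ≤ Z.a g n * Real.log n := by
    rw [Z.mul_log]
    have hnn : ∀ h, ∀ x : ℕ × ℕ, 0 ≤ Z.a (g - h) x.1 * Z.lam h x.2 := fun h x =>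
      mul_nonneg (Z.a_nonneg _ _) (Z.lam_nonneg _ _)
    refine le_trans ?_ (Finset.single_le_sum (f := fun h => (Z.a (g - h) * Z.lam h) n)
      (fun h _ => ?_) (Finset.mem_univ g))
    · simp only [ArithmeticFunction.mul_apply, sub_self]
      refine le_trans ?_ (Finset.single_le_sum (f := fun x : ℕ × ℕ => Z.a 0 x.1 * Z.lam g x.2)
        (fun x _ => mul_nonneg (Z.a_nonneg _ _) (Z.lam_nonneg _ _)) (a := (1, n)) ?_)
      · simp [Z.a_zero_one]
      · simp [hn.ne']
    · simp only [ArithmeticFunction.mul_apply]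
      exact Finset.sum_nonneg fun x _ => hnn h x
  rw [LSeries.logMul, mul_comm, ← Complex.natCast_log]
  exact CStarAlgebra.norm_le_norm_of_nonneg_of_le (Z.lam_nonneg g n) h1

theorem abscissa_le (g : G) : LSeries.abscissaOfAbsConv (Z.a g) ≤ 1 :=
  LSeries.abscissaOfAbsConv_le_of_forall_lt_LSeriesSummable (x := 1) fun y hy =>
      Z.summable g y (by simpa using hy)

theorem lam_summable (g : G) (s : ℂ) (hs : 1 < s.re) : LSeriesSummable (Z.lam g) s := by
  have := LSeriesSummable_logMul_of_lt_re ((Z.abscissa_le g).trans_lt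
    (by exact_mod_cast hs : (1 : EReal) < s.re))
  exact Summable.of_norm_bounded this.norm fun n => LSeries.norm_term_le s (Z.norm_lam_le g n)

theorem _root_.LSeries_charTwist (ψ : AddChar G ℂ) {a : G → ArithmeticFunction ℂ} {s : ℂ}
    (h : ∀ g, LSeriesSummable (a g) s) :
    LSeriesSummable (charTwist ψ a) s ∧
      LSeries (charTwist ψ a) s = ∑ g, ψ g * LSeries (a g) s := by
  have e : (charTwist ψ a : ℕ → ℂ) = ∑ g, ψ g • (a g : ℕ → ℂ) := by
    funext n; simp [charTwist_apply]
  rw [e]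
  refine ⟨LSeriesSummable.sum fun g _ => (h g).smul _, ?_⟩
  rw [LSeries_sum fun g _ => (h g).smul _]
  simp [LSeries_smul]

/-- The entire part of the L-series of a character. -/
noncomputable def twE (ψ : AddChar G ℂ) (s : ℂ) : ℂ := ∑ g, ψ g * Z.E g s

theorem differentiable_twE (ψ : AddChar G ℂ) : Differentiable ℂ (Z.twE ψ) := by
  unfold twE
  have := Z.differentiable_E
  fun_prop

theorem LSeries_twist (ψ : AddChar G ℂ) {s : ℂ} (hs : 1 < s.re) :
    LSeries (charTwist ψ Z.a) s = Z.twE ψ s + (∑ g, ψ g) * (Z.κ / (s - 1)) := by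
  rw [(LSeries_charTwist ψ fun g => Z.summable g s hs).2, twE, Finset.sum_mul,
    ← Finset.sum_add_distrib]
  refine Finset.sum_congr rfl fun g _ => ?_
  rw [Z.LSeries_eq g s hs, mul_add]

theorem LSeries_twist_of_ne {ψ : AddChar G ℂ} (hψ : ψ ≠ 0) {s : ℂ} (hs : 1 < s.re) :
    LSeries (charTwist ψ Z.a) s = Z.twE ψ s := by
  classical
  rw [Z.LSeries_twist ψ hs, AddChar.sum_eq_ite, if_neg hψ, zero_mul, add_zero]

theorem twE_neg_one {ψ : AddChar G ℂ} (hψ : ψ ≠ 0) : Z.twE ψ (-1) = 0 := by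
  classical
  simp only [twE, Z.E_neg_one]
  rw [← Finset.sum_mul, AddChar.sum_eq_ite, if_neg hψ, zero_mul]

theorem charTwist_a_one (ψ : AddChar G ℂ) : charTwist ψ Z.a 1 = 1 := by
  classical
  rw [charTwist_apply, Finset.sum_eq_single 0]
  · simp [Z.a_zero_one]
  · intro g _ hg; simp [Z.a_one g hg]
  · simp

theorem sum_charTwist_lam_nonneg (n : ℕ) :
    0 ≤ (∑ ψ : AddChar G ℂ, charTwist ψ Z.lam) n := by
  classical
  have : (∑ ψ : AddChar G ℂ, charTwist ψ Z.lam) n = ∑ ψ : AddChar G ℂ, charTwist ψ Z.lam n :=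
    map_sum ({ toFun := fun f => f n, map_zero' := rfl, map_add' := fun _ _ => rfl } :
      ArithmeticFunction ℂ →+ ℂ) _ _
  rw [this]
  simp only [charTwist_apply]
  rw [Finset.sum_comm]
  refine Finset.sum_nonneg fun g _ => ?_
  rw [← Finset.sum_mul, AddChar.sum_apply_eq_ite]
  refine mul_nonneg ?_ (Z.lam_nonneg g n)
  split_ifs
  · exact_mod_cast Nat.zero_le _
  · exact le_rfl

theorem twE_one_ne_zero {ψ : AddChar G ℂ} (hψ : ψ ≠ 0) : Z.twE ψ 1 ≠ 0 := by
  classical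
  intro h0
  set A : ArithmeticFunction ℂ := ∏ χ : AddChar G ℂ, charTwist χ Z.a with hA
  have hAlog : ∀ n : ℕ, A n * Real.log n = (A * ∑ χ : AddChar G ℂ, charTwist χ Z.lam) n :=
    ArithmeticFunction.prod_mul_log _ _ _ fun χ _ n => charTwist_mul_log χ Z.mul_log n
  have hA1 : A 1 = 1 := by
    have : ∀ s : Finset (AddChar G ℂ), (∏ χ ∈ s, charTwist χ Z.a) 1 = 1 := by
      intro s
      induction s using Finset.induction_on with
      | empty => simp
      | insert i s hi ih => simp [Finset.prod_insert hi, ih, Z.charTwist_a_one]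
    exact this _
  have hA0 : 0 ≤ (A ·) := ArithmeticFunction.nonneg_of_mul_log hA1 hAlog Z.sum_charTwist_lam_nonneg
  have hAL : ∀ s : ℂ, 1 < s.re → LSeriesSummable A s ∧
      LSeries A s = ∏ χ : AddChar G ℂ, LSeries (charTwist χ Z.a) s := fun s hs =>
    ArithmeticFunction.LSeries_prod _ _ fun χ _ =>
      (LSeries_charTwist χ fun g => Z.summable g s hs).1
  set F : ℂ → ℂ := fun s => (∏ χ ∈ (Finset.univ.erase 0).erase ψ, Z.twE χ s) *
    (Z.twE 0 s * Z.twE ψ s + (Fintype.card G * Z.κ) * dslope (Z.twE ψ) 1 s) with hF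
  have hdF : Differentiable ℂ F := by
    have h1 : Differentiable ℂ (dslope (Z.twE ψ) 1) := by
      rw [← differentiableOn_univ, Complex.differentiableOn_dslope Filter.univ_mem,
        differentiableOn_univ]
      exact Z.differentiable_twE ψ
    have h2 := Z.differentiable_twE
    fun_prop
  have hpos := ArithmeticFunction.LSeries_positive_of_differentiable_of_eqOn (a := A) hA0
    (by simp [hA1]) hdF (x := 1)
    (LSeries.abscissaOfAbsConv_le_of_forall_lt_LSeriesSummable (x := 1) fun y hy =>
      (hAL y (by simpa using hy)).1) (fun s hs => ?_) (-1)
  · have hne : (-1 : ℂ) ≠ 1 := by norm_num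
    simp [hF, dslope_of_ne _ hne, slope, Z.twE_neg_one hψ, h0] at hpos
  · have hs' : 1 < s.re := hs
    have hne : s ≠ 1 := by rintro rfl; simp at hs'
    rw [(hAL s hs').2, ← Finset.mul_prod_erase _ _ (Finset.mem_univ 0),
      ← Finset.mul_prod_erase _ _ (Finset.mem_erase.2 ⟨hψ, Finset.mem_univ ψ⟩),
      Z.LSeries_twist_of_ne hψ hs', Z.LSeries_twist 0 hs', hF]
    simp only [dslope_of_ne _ hne, slope, h0]
    rw [Finset.prod_congr rfl fun χ hχ => Z.LSeries_twist_of_ne (ψ := χ) (by simp_all) hs']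
    have : s - 1 ≠ 0 := sub_ne_zero.2 hne
    simp
    field_simp

theorem LSeries_lam_eq (ψ : AddChar G ℂ) {s : ℂ} (hs : 1 < s.re) :
    HasDerivAt (LSeries (charTwist ψ Z.a))
      (-(LSeries (charTwist ψ Z.a) s * LSeries (charTwist ψ Z.lam) s)) s :=
  LSeries_deriv_eq_neg_mul (fun z hz => (LSeries_charTwist ψ fun g => Z.summable g z hz).1)
    (fun z hz => (LSeries_charTwist ψ fun g => Z.lam_summable g z hz).1)
    (charTwist_mul_log ψ Z.mul_log) hs

theorem eventually_one_lt : ∀ᶠ x : ℝ in 𝓝[>] 1, 1 < (x : ℂ).re := by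
  filter_upwards [self_mem_nhdsWithin] with x hx
  simpa using hx

theorem tendsto_ofReal_one : Tendsto (fun x : ℝ => (x : ℂ)) (𝓝[>] 1) (𝓝 1) :=
  (Complex.continuous_ofReal.tendsto' 1 1 (by simp)).mono_left nhdsWithin_le_nhds

theorem eventuallyEq_of_one_lt {f g : ℂ → ℂ} (h : ∀ s : ℂ, 1 < s.re → f s = g s) {s : ℂ}
    (hs : 1 < s.re) : f =ᶠ[𝓝 s] g := by
  filter_upwards [(isOpen_lt continuous_const Complex.continuous_re).mem_nhds hs] with z hz
  exact h z hz

theorem tendsto_lam_of_ne {ψ : AddChar G ℂ} (hψ : ψ ≠ 0) :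
    Tendsto (fun x : ℝ => ((x : ℂ) - 1) * LSeries (charTwist ψ Z.lam) x) (𝓝[>] 1) (𝓝 0) := by
  have hd := Z.differentiable_twE ψ
  have hd' : Continuous (deriv (Z.twE ψ)) := hd.contDiff.continuous_deriv le_top
  have h1 : Tendsto (fun x : ℝ => ((x : ℂ) - 1) * (-(deriv (Z.twE ψ) x / Z.twE ψ x)))
      (𝓝[>] 1) (𝓝 ((1 - 1) * (-(deriv (Z.twE ψ) 1 / Z.twE ψ 1)))) :=
    (tendsto_ofReal_one.sub_const 1).mul
      ((((hd'.tendsto 1).comp tendsto_ofReal_one).div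
        ((hd.continuous.tendsto 1).comp tendsto_ofReal_one) (Z.twE_one_ne_zero hψ)).neg)
  rw [sub_self, zero_mul] at h1
  have hne : ∀ᶠ x : ℝ in 𝓝[>] 1, Z.twE ψ x ≠ 0 :=
    ((hd.continuous.tendsto 1).comp tendsto_ofReal_one).eventually_ne (Z.twE_one_ne_zero hψ)
  refine h1.congr' ?_
  filter_upwards [eventually_one_lt, hne] with x hx hx0
  have e := eventuallyEq_of_one_lt (fun s hs => Z.LSeries_twist_of_ne hψ hs) hx
  have := (Z.LSeries_lam_eq ψ hx).unique ((hd x).hasDerivAt.congr_of_eventuallyEq e)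
  have e0 : LSeries (charTwist ψ Z.a) x = Z.twE ψ x := e.self_of_nhds
  rw [← this, e0]
  field_simp

theorem tendsto_lam_zero :
    Tendsto (fun x : ℝ => ((x : ℂ) - 1) * LSeries (charTwist (0 : AddChar G ℂ) Z.lam) x)
      (𝓝[>] 1) (𝓝 1) := by
  set r : ℂ := Fintype.card G * Z.κ with hr
  have hr0 : r ≠ 0 := mul_ne_zero (by exact_mod_cast Fintype.card_ne_zero) Z.κ_ne_zero
  set H : ℂ → ℂ := fun s => (s - 1) * Z.twE 0 s + r with hH
  have hd : Differentiable ℂ H := by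
    have := Z.differentiable_twE 0
    fun_prop
  have hH1 : H 1 ≠ 0 := by simpa [hH] using hr0
  have hd' : Continuous (deriv H) := hd.contDiff.continuous_deriv le_top
  have h1 : Tendsto (fun x : ℝ => 1 + ((x : ℂ) - 1) * (-(deriv H x / H x)))
      (𝓝[>] 1) (𝓝 (1 + (1 - 1) * (-(deriv H 1 / H 1)))) :=
    ((tendsto_ofReal_one.sub_const 1).mul
      ((((hd'.tendsto 1).comp tendsto_ofReal_one).div
        ((hd.continuous.tendsto 1).comp tendsto_ofReal_one) hH1).neg)).const_add 1
  rw [sub_self, zero_mul, add_zero] at h1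
  have hne : ∀ᶠ x : ℝ in 𝓝[>] 1, H x ≠ 0 :=
    ((hd.continuous.tendsto 1).comp tendsto_ofReal_one).eventually_ne hH1
  refine h1.congr' ?_
  filter_upwards [eventually_one_lt, hne] with x hx hx0
  have hx1 : (x : ℂ) - 1 ≠ 0 := by
    rw [sub_ne_zero]; rintro h; simp [h] at hx
  have e : LSeries (charTwist (0 : AddChar G ℂ) Z.a) =ᶠ[𝓝 (x : ℂ)] fun s => H s / (s - 1) := by
    refine eventuallyEq_of_one_lt (fun s hs => ?_) hx
    have : s - 1 ≠ 0 := by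
      rw [sub_ne_zero]; rintro rfl; simp at hs
    rw [Z.LSeries_twist 0 hs]
    simp only [hH, hr, AddChar.zero_apply, Finset.sum_const, Finset.card_univ, nsmul_eq_mul]
    field_simp
  have hder := ((hd x).hasDerivAt.div ((hasDerivAt_id (x : ℂ)).sub_const 1) hx1)
  have := (Z.LSeries_lam_eq 0 hx).unique (hder.congr_of_eventuallyEq e)
  rw [e.self_of_nhds] at this
  simp only [id] at this
  field_simp at this ⊢
  linear_combination this

theorem tendsto_lam (g : G) :
    Tendsto (fun x : ℝ => ((x : ℂ) - 1) * LSeries (Z.lam g) x) (𝓝[>] 1)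
      (𝓝 ((Fintype.card G : ℂ)⁻¹)) := by
  classical
  have hsum : Tendsto (fun x : ℝ => (Fintype.card G : ℂ)⁻¹ * ∑ ψ : AddChar G ℂ,
      ψ (-g) * (((x : ℂ) - 1) * LSeries (charTwist ψ Z.lam) x)) (𝓝[>] 1)
      (𝓝 ((Fintype.card G : ℂ)⁻¹ * ∑ ψ : AddChar G ℂ, ψ (-g) * (if ψ = 0 then 1 else 0))) := by
    refine (tendsto_finsetSum _ fun ψ _ => ?_).const_mul _
    refine Tendsto.const_mul _ ?_
    split_ifs with h
    · subst h; exact Z.tendsto_lam_zero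
    · exact Z.tendsto_lam_of_ne h
  simp only [mul_ite, mul_one, mul_zero, Finset.sum_ite_eq', Finset.mem_univ, if_true,
    AddChar.zero_apply] at hsum
  refine hsum.congr' ?_
  filter_upwards [eventually_one_lt] with x hx
  have h0 : (Fintype.card G : ℂ) ≠ 0 := by exact_mod_cast Fintype.card_ne_zero
  rw [Finset.sum_congr rfl fun ψ _ => by
    rw [(LSeries_charTwist ψ fun g => Z.lam_summable g x hx).2]]
  have : ∀ ψ : AddChar G ℂ, ψ (-g) * (((x : ℂ) - 1) * ∑ k, ψ k * LSeries (Z.lam k) x) =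
      ∑ k, ψ (k - g) * (((x : ℂ) - 1) * LSeries (Z.lam k) x) := by
    intro ψ
    rw [Finset.mul_sum, Finset.mul_sum]
    refine Finset.sum_congr rfl fun k _ => ?_
    rw [sub_eq_add_neg k, AddChar.map_add_eq_mul]
    ring
  rw [Finset.sum_congr rfl fun ψ _ => this ψ, Finset.sum_comm]
  simp only [← Finset.sum_mul, AddChar.sum_apply_eq_ite, sub_eq_zero, ite_mul, zero_mul,
    Finset.sum_ite_eq', Finset.mem_univ, if_true]
  field_simp

/-- In every class, the sum of `Λ(n) / n` diverges. -/
theorem not_summable (g : G) : ¬ Summable fun n : ℕ => ‖Z.lam g n‖ / n := by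
  intro hS
  have hb : ∀ x : ℝ, 1 < x → ‖LSeries (Z.lam g) x‖ ≤ ∑' n : ℕ, ‖Z.lam g n‖ / n := by
    intro x hx
    refine tsum_of_norm_bounded hS.hasSum fun n => ?_
    rw [LSeries.norm_term_eq]
    split_ifs with hn
    · simp [hn]
    · have h1 : (1 : ℝ) ≤ n := by exact_mod_cast Nat.one_le_iff_ne_zero.2 hn
      refine div_le_div_of_nonneg_left (norm_nonneg _) (by positivity) ?_
      simpa using Real.rpow_le_rpow_of_exponent_le h1 hx.le
  have h0 : Tendsto (fun x : ℝ => ((x : ℂ) - 1) * LSeries (Z.lam g) x) (𝓝[>] 1) (𝓝 0) := by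
    rw [tendsto_zero_iff_norm_tendsto_zero]
    have hz : Tendsto (fun x : ℝ => ‖(x : ℂ) - 1‖ * ∑' n : ℕ, ‖Z.lam g n‖ / n) (𝓝[>] 1)
        (𝓝 (‖(1 : ℂ) - 1‖ * ∑' n : ℕ, ‖Z.lam g n‖ / n)) :=
      (tendsto_ofReal_one.sub_const 1).norm.mul_const _
    rw [sub_self, norm_zero, zero_mul] at hz
    refine squeeze_zero' (Eventually.of_forall fun _ => norm_nonneg _) ?_ hz
    filter_upwards [self_mem_nhdsWithin] with x hx
    rw [norm_mul]
    exact mul_le_mul_of_nonneg_left (hb x hx) (norm_nonneg _)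
  have := tendsto_nhds_unique h0 (Z.tendsto_lam g)
  have h0 : (Fintype.card G : ℂ) ≠ 0 := by exact_mod_cast Fintype.card_ne_zero
  exact inv_ne_zero h0 this.symm

end PartialZetaData

end

section

open Filter Topology Set Asymptotics
open scoped Real

/-- The real binary quadratic form `A x² + B x y + C y²` on `ℤ × ℤ`. -/
def latticeForm (A B C : ℝ) (v : ℤ × ℤ) : ℝ := A * v.1 ^ 2 + B * v.1 * v.2 + C * v.2 ^ 2

section

variable {A B C : ℝ}

theorem latticeForm_lower (h : 4 * A * C - B ^ 2 = 4) (v : ℤ × ℤ) :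
    (v.1 : ℝ) ^ 2 + (v.2 : ℝ) ^ 2 ≤ (A + C) * latticeForm A B C v := by
  unfold latticeForm
  nlinarith [sq_nonneg (A * v.1 + B * v.2 / 2), sq_nonneg (B * v.1 / 2 + C * v.2)]

theorem latticeForm_trace_pos (hA : 0 < A) (h : 4 * A * C - B ^ 2 = 4) : 0 < A + C := by
  have : 0 < C := by
    by_contra hc
    nlinarith [sq_nonneg B]
  linarith

theorem latticeForm_lower' (hA : 0 < A) (h : 4 * A * C - B ^ 2 = 4) (v : ℤ × ℤ) :
    (A + C)⁻¹ * ((v.1 : ℝ) ^ 2 + (v.2 : ℝ) ^ 2) ≤ latticeForm A B C v := by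
  rw [inv_mul_le_iff₀ (latticeForm_trace_pos hA h)]
  exact latticeForm_lower h v

theorem one_le_sq_add_sq {v : ℤ × ℤ} (hv : v ≠ 0) : (1 : ℝ) ≤ (v.1 : ℝ) ^ 2 + (v.2 : ℝ) ^ 2 := by
  have : 1 ≤ v.1 ^ 2 + v.2 ^ 2 := by
    by_contra hc
    apply hv
    have h1 := sq_nonneg v.1
    have h2 := sq_nonneg v.2
    ext
    · exact pow_eq_zero_iff two_ne_zero |>.1 (by omega)
    · exact pow_eq_zero_iff two_ne_zero |>.1 (by omega)
  exact_mod_cast this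

theorem latticeForm_pos (hA : 0 < A) (h : 4 * A * C - B ^ 2 = 4) {v : ℤ × ℤ} (hv : v ≠ 0) :
    (A + C)⁻¹ ≤ latticeForm A B C v := by
  have h1 := inv_pos.2 (latticeForm_trace_pos hA h)
  nlinarith [latticeForm_lower' hA h v, one_le_sq_add_sq hv]

theorem summable_exp_neg_mul_int_sq {ε : ℝ} (hε : 0 < ε) :
    Summable fun n : ℤ => Real.exp (-ε * (n : ℝ) ^ 2) := by
  have hpi := Real.pi_pos
  refine (summable_pow_mul_jacobiTheta₂_term_bound 0 (div_pos hε hpi) 0).congr fun n => ?_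
  rw [pow_zero, one_mul]
  congr 1
  field_simp
  ring

theorem summable_exp_neg_sq_add_sq {ε η : ℝ} (hε : 0 < ε) (hη : 0 < η) :
    Summable fun v : ℤ × ℤ => Real.exp (-ε * (v.1 : ℝ) ^ 2) * Real.exp (-η * (v.2 : ℝ) ^ 2) :=
  (summable_exp_neg_mul_int_sq hε).mul_of_nonneg (summable_exp_neg_mul_int_sq hη)
    (fun _ => (Real.exp_pos _).le) (fun _ => (Real.exp_pos _).le)

theorem summable_exp_latticeForm (hA : 0 < A) (h : 4 * A * C - B ^ 2 = 4) {t : ℝ} (ht : 0 < t) :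
    Summable fun v : ℤ × ℤ => Real.exp (-t * latticeForm A B C v) := by
  have h1 := inv_pos.2 (latticeForm_trace_pos hA h)
  refine (summable_exp_neg_sq_add_sq (mul_pos ht h1) (mul_pos ht h1)).of_nonneg_of_le
    (fun _ => (Real.exp_pos _).le) fun v => ?_
  rw [← Real.exp_add]
  apply Real.exp_le_exp.2
  nlinarith [latticeForm_lower' hA h v]

/-- The theta series of a real binary quadratic form. -/
noncomputable def latticeTheta (A B C t : ℝ) : ℝ :=
  ∑' v : ℤ × ℤ, Real.exp (-(π * t) * latticeForm A B C v)

/-- The partial Fourier dual of the theta series. -/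
noncomputable def mixedTheta (A B t : ℝ) : ℂ :=
  ∑' v : ℤ × ℤ, Complex.exp (-π / (A * t) * v.1 ^ 2 - π * t / A * v.2 ^ 2
    + Complex.I * π * B * v.1 * v.2 / A)

theorem norm_mixedTheta_term (t : ℝ) (v : ℤ × ℤ) :
    ‖Complex.exp (-π / (A * t) * v.1 ^ 2 - π * t / A * v.2 ^ 2
      + Complex.I * π * B * v.1 * v.2 / A)‖ =
    Real.exp (-(π / (A * t)) * (v.1 : ℝ) ^ 2) * Real.exp (-(π * t / A) * (v.2 : ℝ) ^ 2) := by
  rw [Complex.norm_exp, ← Real.exp_add]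
  congr 1
  have : (-π / (A * t) * v.1 ^ 2 - π * t / A * v.2 ^ 2
      + Complex.I * π * B * v.1 * v.2 / A : ℂ) =
      ((-(π / (A * t)) * (v.1 : ℝ) ^ 2 + -(π * t / A) * (v.2 : ℝ) ^ 2 : ℝ) : ℂ) +
      ((π * B * v.1 * v.2 / A : ℝ) : ℂ) * Complex.I := by
    push_cast; ring
  rw [this, Complex.add_re, Complex.ofReal_re, Complex.re_ofReal_mul, Complex.I_re, mul_zero,
    add_zero]

theorem summable_mixedTheta (hA : 0 < A) {t : ℝ} (ht : 0 < t) :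
    Summable fun v : ℤ × ℤ => Complex.exp (-π / (A * t) * v.1 ^ 2 - π * t / A * v.2 ^ 2
      + Complex.I * π * B * v.1 * v.2 / A) := by
  refine Summable.of_norm ?_
  simp_rw [norm_mixedTheta_term]
  have := Real.pi_pos
  exact summable_exp_neg_sq_add_sq (by positivity) (by positivity)

theorem mixedTheta_inv (hA : 0 < A) {t : ℝ} (ht : 0 < t) :
    mixedTheta A B (1 / t) = mixedTheta A B t := by
  unfold mixedTheta
  rw [← (Equiv.prodComm ℤ ℤ).tsum_eq]
  refine tsum_congr fun v => ?_
  congr 1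
  have hA' : (A : ℂ) ≠ 0 := by exact_mod_cast hA.ne'
  have ht' : (t : ℂ) ≠ 0 := by exact_mod_cast ht.ne'
  simp
  field_simp
  ring

theorem latticeTheta_eq_mixedTheta (hA : 0 < A) (h : 4 * A * C - B ^ 2 = 4) {t : ℝ} (ht : 0 < t) :
    (latticeTheta A B C t : ℂ) = ((1 / Real.sqrt (A * t) : ℝ) : ℂ) * mixedTheta A B t := by
  have hpi := Real.pi_pos
  have hA' : (A : ℂ) ≠ 0 := by exact_mod_cast hA.ne'
  have ht' : (t : ℂ) ≠ 0 := by exact_mod_cast ht.ne'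
  have hsum := summable_exp_latticeForm hA h (mul_pos hpi ht)
  unfold latticeTheta mixedTheta
  rw [Complex.ofReal_tsum]
  have hsumC : Summable fun v : ℤ × ℤ =>
      ((Real.exp (-(π * t) * latticeForm A B C v) : ℝ) : ℂ) := by exact_mod_cast hsum
  have hsum1 : Summable fun v : ℤ × ℤ =>
      ((Real.exp (-(π * t) * latticeForm A B C (v.2, v.1)) : ℝ) : ℂ) :=
    (Equiv.prodComm ℤ ℤ).summable_iff.2 hsumC
  have hsum2 : Summable fun v : ℤ × ℤ =>
      Complex.exp (-π / (A * t) * v.2 ^ 2 - π * t / A * v.1 ^ 2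
        + Complex.I * π * B * v.2 * v.1 / A) :=
    (Equiv.prodComm ℤ ℤ).summable_iff.2 (summable_mixedTheta (B := B) hA ht)
  rw [← (Equiv.prodComm ℤ ℤ).tsum_eq, ← (Equiv.prodComm ℤ ℤ).tsum_eq (fun v : ℤ × ℤ =>
    Complex.exp (-π / (A * t) * v.1 ^ 2 - π * t / A * v.2 ^ 2
      + Complex.I * π * B * v.1 * v.2 / A))]
  simp only [Equiv.prodComm_apply, Prod.swap]
  rw [hsum1.tsum_prod, hsum2.tsum_prod, ← tsum_mul_left]
  refine tsum_congr fun y => ?_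
  have hre : 0 < ((A * t : ℝ) : ℂ).re := by simpa using mul_pos hA ht
  have key := Complex.tsum_exp_neg_quadratic hre (-(t * B * y / 2 : ℝ) : ℂ)
  have hsq : (((A * t : ℝ) : ℂ) ^ (1 / 2 : ℂ)) = ((Real.sqrt (A * t) : ℝ) : ℂ) := by
    rw [Real.sqrt_eq_rpow, Complex.ofReal_cpow (mul_pos hA ht).le]; norm_num
  rw [hsq] at key
  have e1 : ∀ x : ℤ, ((Real.exp (-(π * t) * latticeForm A B C (x, y)) : ℝ) : ℂ)
      = Complex.exp (-(π * t * C * y ^ 2)) *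
        Complex.exp (-π * (A * t : ℝ) * x ^ 2 + 2 * π * (-(t * B * y / 2 : ℝ) : ℂ) * x) := by
    intro x
    rw [Complex.ofReal_exp, ← Complex.exp_add]
    congr 1
    simp [latticeForm]
    ring
  simp_rw [e1]
  rw [tsum_mul_left, key, ← mul_assoc, mul_comm (Complex.exp _), mul_assoc, ← tsum_mul_left]
  push_cast
  congr 1
  refine tsum_congr fun x => ?_
  rw [← Complex.exp_add]
  congr 1
  have hh : (B : ℂ) ^ 2 = 4 * A * C - 4 := by
    have : B ^ 2 = 4 * A * C - 4 := by linarith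
    exact_mod_cast this
  simp
  field_simp
  ring_nf
  rw [Complex.I_sq, hh]
  ring

theorem latticeTheta_inv (hA : 0 < A) (h : 4 * A * C - B ^ 2 = 4) {t : ℝ} (ht : 0 < t) :
    latticeTheta A B C (1 / t) = t * latticeTheta A B C t := by
  rw [← Complex.ofReal_inj]
  push_cast
  rw [latticeTheta_eq_mixedTheta hA h ht, latticeTheta_eq_mixedTheta hA h (one_div_pos.2 ht),
    mixedTheta_inv hA ht, ← mul_assoc]
  congr 1
  rw [← Complex.ofReal_mul]
  congr 1
  rw [Real.sqrt_mul hA.le, Real.sqrt_mul hA.le, one_div t, Real.sqrt_inv]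
  have h1 : Real.sqrt A ≠ 0 := (Real.sqrt_pos.2 hA).ne'
  have h2 : Real.sqrt t ≠ 0 := (Real.sqrt_pos.2 ht).ne'
  field_simp
  rw [Real.sq_sqrt ht.le]

end

end

section

open Filter Topology Set Asymptotics
open scoped Real

section

variable {A B C : ℝ}

theorem summable_latticeForm_rpow (hA : 0 < A) (h : 4 * A * C - B ^ 2 = 4) {σ : ℝ} (hσ : 1 < σ) :
    Summable fun v : ℤ × ℤ => if v = 0 then 0 else 1 / latticeForm A B C v ^ σ := by
  have hAC := latticeForm_trace_pos hA h
  have h1 : Summable fun x : Fin 2 → ℤ => ‖x‖ ^ (-(2 * σ)) :=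
    EisensteinSeries.summable_one_div_norm_rpow (by linarith)
  have h2 : Summable fun v : ℤ × ℤ => (A + C) ^ σ * ‖v‖ ^ (-(2 * σ)) := by
    refine (((finTwoArrowEquiv ℤ).symm.summable_iff.2 h1).congr fun v => ?_).mul_left _
    have : ‖(finTwoArrowEquiv ℤ).symm v‖ = ‖v‖ := by
      rw [Prod.norm_def]
      refine le_antisymm ((pi_norm_le_iff_of_nonneg (by positivity)).2 fun i => ?_)
        (max_le (norm_le_pi_norm ((finTwoArrowEquiv ℤ).symm v) 0)
          (norm_le_pi_norm ((finTwoArrowEquiv ℤ).symm v) 1))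
      fin_cases i
      · exact le_max_left _ _
      · exact le_max_right _ _
    rw [Function.comp_apply, this]
  refine h2.of_nonneg_of_le (fun v => ?_) fun v => ?_
  · split_ifs with hv
    · exact le_rfl
    · exact one_div_nonneg.2 (Real.rpow_nonneg
        ((inv_pos.2 hAC).le.trans (latticeForm_pos hA h hv)) _)
  · split_ifs with hv
    · positivity
    · have hn : 0 < ‖v‖ := norm_pos_iff.2 hv
      have hP : 0 < latticeForm A B C v := (inv_pos.2 hAC).trans_le (latticeForm_pos hA h hv)
      have hle : ‖v‖ ^ 2 ≤ (A + C) * latticeForm A B C v := by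
        refine le_trans ?_ (latticeForm_lower h v)
        rw [Prod.norm_def]
        rcases max_choice ‖v.1‖ ‖v.2‖ with e | e <;> rw [e, Int.norm_eq_abs, sq_abs]
        · nlinarith [sq_nonneg (v.2 : ℝ)]
        · nlinarith [sq_nonneg (v.1 : ℝ)]
      rw [Real.rpow_neg hn.le, Real.rpow_mul hn.le, ← div_eq_mul_inv, div_le_div_iff₀
        (by positivity) (by positivity), one_mul, ← Real.mul_rpow hAC.le hP.le]
      exact Real.rpow_le_rpow (by positivity) (by exact_mod_cast hle) (by linarith)

theorem hasSum_latticeTheta (hA : 0 < A) (h : 4 * A * C - B ^ 2 = 4) {t : ℝ} (ht : 0 < t) :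
    HasSum (fun v : ℤ × ℤ => Real.exp (-(π * t) * latticeForm A B C v)) (latticeTheta A B C t) :=
  (summable_exp_latticeForm hA h (mul_pos Real.pi_pos ht)).hasSum

theorem hasSum_latticeTheta_sub_one (hA : 0 < A) (h : 4 * A * C - B ^ 2 = 4) {t : ℝ}
    (ht : 0 < t) :
    HasSum (fun v : ℤ × ℤ => if v = 0 then 0 else Real.exp (-(π * t) * latticeForm A B C v))
      (latticeTheta A B C t - 1) := by
  have := (hasSum_latticeTheta hA h ht).sub (hasSum_ite_eq (0 : ℤ × ℤ) (1 : ℝ))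
  refine this.congr_fun fun v => ?_
  split_ifs with hv
  · simp [hv, latticeForm]
  · simp

theorem continuousOn_latticeTheta (hA : 0 < A) (h : 4 * A * C - B ^ 2 = 4) :
    ContinuousOn (latticeTheta A B C) (Ioi 0) := by
  have hAC := latticeForm_trace_pos hA h
  have hpi := Real.pi_pos
  intro t ht
  have ht' : 0 < t / 2 := half_pos ht
  refine ContinuousAt.continuousWithinAt ?_
  have : ContinuousOn (latticeTheta A B C) (Ici (t / 2)) := by
    refine continuousOn_tsum (fun v => by fun_prop)
      (summable_exp_latticeForm hA h (mul_pos hpi ht')) fun v x hx => ?_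
    rw [Real.norm_of_nonneg (Real.exp_pos _).le]
    apply Real.exp_le_exp.2
    have hP : 0 ≤ latticeForm A B C v :=
      le_trans (mul_nonneg (inv_pos.2 hAC).le (by positivity)) (latticeForm_lower' hA h v)
    have hx' : t / 2 ≤ x := hx
    nlinarith [mul_le_mul_of_nonneg_right (mul_le_mul_of_nonneg_left hx' hpi.le) hP]
  exact this.continuousAt (Ici_mem_nhds (half_lt_self ht))

theorem latticeTheta_sub_one_le (hA : 0 < A) (h : 4 * A * C - B ^ 2 = 4) {t : ℝ} (ht : 1 ≤ t) :
    |latticeTheta A B C t - 1| ≤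
      (latticeTheta A B C 1 - 1) * Real.exp (-(π * (A + C)⁻¹) * (t - 1)) := by
  have hAC := latticeForm_trace_pos hA h
  have hpi := Real.pi_pos
  have h1 := hasSum_latticeTheta_sub_one hA h (zero_lt_one.trans_le ht)
  have h2 := (hasSum_latticeTheta_sub_one hA h zero_lt_one).mul_right
    (Real.exp (-(π * (A + C)⁻¹) * (t - 1)))
  rw [abs_of_nonneg (h1.nonneg fun v => by split_ifs; exacts [le_rfl, (Real.exp_pos _).le])]
  refine hasSum_le (fun v => ?_) h1 h2
  split_ifs with hv
  · simp
  · rw [← Real.exp_add]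
    apply Real.exp_le_exp.2
    nlinarith [mul_nonneg (mul_nonneg hpi.le (sub_nonneg.2 ht))
      (sub_nonneg.2 (latticeForm_pos hA h hv))]

theorem isBigO_latticeTheta_sub_one (hA : 0 < A) (h : 4 * A * C - B ^ 2 = 4) (r : ℝ) :
    (fun t => (latticeTheta A B C t : ℂ) - 1) =O[atTop] (fun t : ℝ => t ^ r) := by
  have hAC := latticeForm_trace_pos hA h
  have hpi := Real.pi_pos
  set b := π * (A + C)⁻¹ with hb
  have hb0 : 0 < b := by positivity
  have h1 : (fun t => (latticeTheta A B C t : ℂ) - 1) =O[atTop] fun t : ℝ => Real.exp (-b * t) := by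
    refine IsBigO.of_bound ((latticeTheta A B C 1 - 1) * Real.exp b) ?_
    filter_upwards [eventually_ge_atTop 1] with t ht
    have := latticeTheta_sub_one_le hA h ht
    rw [← Complex.ofReal_one, ← Complex.ofReal_sub, Complex.norm_real, Real.norm_eq_abs,
      Real.norm_of_nonneg (Real.exp_pos _).le, mul_assoc, ← Real.exp_add]
    refine this.trans (le_of_eq ?_)
    congr 2
    ring
  exact h1.trans (isLittleO_exp_neg_mul_rpow_atTop hb0 r).isBigO

/-- The weak functional equation pair attached to the theta series of a form of
discriminant `-4`. -/
noncomputable def latticeFEPair (A B C : ℝ) (hA : 0 < A) (h : 4 * A * C - B ^ 2 = 4) :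
    WeakFEPair ℂ where
  f t := latticeTheta A B C t
  g t := latticeTheta A B C t
  k := 1
  ε := 1
  f₀ := 1
  g₀ := 1
  hf_int := (Complex.continuous_ofReal.comp_continuousOn
    (continuousOn_latticeTheta hA h)).locallyIntegrableOn measurableSet_Ioi
  hg_int := (Complex.continuous_ofReal.comp_continuousOn
    (continuousOn_latticeTheta hA h)).locallyIntegrableOn measurableSet_Ioi
  hk := one_pos
  hε := one_ne_zero
  h_feq x hx := by
    rw [latticeTheta_inv hA h hx]
    simp
  hf_top := isBigO_latticeTheta_sub_one hA h
  hg_top := isBigO_latticeTheta_sub_one hA h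

theorem hasSum_latticeForm_cpow_aux (hA : 0 < A) (h : 4 * A * C - B ^ 2 = 4) {s : ℂ}
    (hs : 1 < s.re) :
    HasSum (fun v : ℤ × ℤ => Complex.Gamma s * (if v = 0 then 0 else 1) /
        ((π * latticeForm A B C v : ℝ) : ℂ) ^ s)
      ((latticeFEPair A B C hA h).Λ₀ s - 1 / s + 1 / (s - 1)) := by
  have hpi := Real.pi_pos
  have hAC := latticeForm_trace_pos hA h
  have hpos : ∀ v : ℤ × ℤ, v ≠ 0 → 0 < latticeForm A B C v := fun v hv =>
    (inv_pos.2 hAC).trans_le (latticeForm_pos hA h hv)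
  have hm := (latticeFEPair A B C hA h).hasMellin (s := s) hs
  have hval : (latticeFEPair A B C hA h).Λ s =
      (latticeFEPair A B C hA h).Λ₀ s - 1 / s + 1 / (s - 1) := by
    rw [WeakFEPair.Λ]
    simp only [latticeFEPair, smul_eq_mul, mul_one, Complex.ofReal_one]
    rw [← neg_sub s 1, div_neg, sub_neg_eq_add]
  rw [← hval, ← hm.2]
  refine hasSum_mellin (a := fun v : ℤ × ℤ => if v = 0 then 0 else 1)
    (p := fun v : ℤ × ℤ => π * latticeForm A B C v) (fun v => ?_) (by linarith)
    (fun t ht => ?_) ?_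
  · by_cases hv : v = 0
    · simp [hv]
    · exact Or.inr (mul_pos hpi (hpos v hv))
  · have := Complex.hasSum_ofReal.2 (hasSum_latticeTheta_sub_one hA h ht)
    simp only [latticeFEPair]
    rw [← Complex.ofReal_one, ← Complex.ofReal_sub]
    refine this.congr_fun fun v => ?_
    split_ifs
    · simp
    · rw [Complex.ofReal_one, one_mul]
      congr 2
      ring
  · refine ((summable_latticeForm_rpow hA h hs).mul_left (1 / π ^ s.re)).congr fun v => ?_
    split_ifs with hv
    · simp
    · rw [Real.mul_rpow hpi.le (hpos v hv).le, norm_one]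
      field_simp

end

end

section

open Filter Topology Set Asymptotics
open scoped Real

/-- The entire part of the Epstein zeta function of a binary quadratic form, given the entire
part `L` of its completion. -/
noncomputable def epsteinEntire (c : ℝ) (L : ℂ → ℂ) (s : ℂ) : ℂ :=
  (c : ℂ) ^ s * (Complex.Gamma s)⁻¹ * L s - (c : ℂ) ^ s * (Complex.Gamma (s + 1))⁻¹ +
    dslope (fun z => (c : ℂ) ^ z * (Complex.Gamma z)⁻¹) 1 s

section

variable {A B C δ : ℝ}

theorem differentiable_cpow_mul_Gamma_inv {c : ℝ} (hc : 0 < c) :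
    Differentiable ℂ fun z => (c : ℂ) ^ z * (Complex.Gamma z)⁻¹ := by
  have hc' : (c : ℂ) ≠ 0 := by exact_mod_cast hc.ne'
  exact (differentiable_id.const_cpow (Or.inl hc')).mul Complex.differentiable_one_div_Gamma

theorem differentiable_epsteinEntire {c : ℝ} (hc : 0 < c) {L : ℂ → ℂ} (hL : Differentiable ℂ L) :
    Differentiable ℂ (epsteinEntire c L) := by
  have hc' : (c : ℂ) ≠ 0 := by exact_mod_cast hc.ne'
  have h1 := differentiable_cpow_mul_Gamma_inv hc
  have h2 : Differentiable ℂ fun s : ℂ => (Complex.Gamma (s + 1))⁻¹ :=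
    Complex.differentiable_one_div_Gamma.comp (differentiable_id.add_const 1)
  have h3 : Differentiable ℂ (dslope (fun z => (c : ℂ) ^ z * (Complex.Gamma z)⁻¹) 1) := by
    rw [← differentiableOn_univ, Complex.differentiableOn_dslope univ_mem]
    exact h1.differentiableOn
  exact ((h1.mul hL).sub ((differentiable_id.const_cpow (Or.inl hc')).mul h2)).add h3

theorem epsteinEntire_neg_one {c : ℝ} (L : ℂ → ℂ) : epsteinEntire c L (-1) = c / 2 := by
  have h0 : Complex.Gamma (-1) = 0 := by
    have := Complex.Gamma_neg_nat_eq_zero 1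
    simpa using this
  unfold epsteinEntire
  rw [dslope_of_ne _ (by norm_num), slope_def_field]
  simp only [h0, inv_zero, mul_zero, zero_mul, neg_add_cancel, Complex.Gamma_zero, Complex.cpow_one,
    Complex.Gamma_one, inv_one, mul_one]
  ring

theorem epsteinEntire_add {c : ℝ} (L : ℂ → ℂ) {s : ℂ} (hs : 1 < s.re) :
    epsteinEntire c L s + c / (s - 1) =
      (c : ℂ) ^ s * (Complex.Gamma s)⁻¹ * (L s - 1 / s + 1 / (s - 1)) := by
  have hs0 : s ≠ 0 := by rintro rfl; norm_num at hs
  have hs1 : s ≠ 1 := by rintro rfl; norm_num at hs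
  have hs1' : s - 1 ≠ 0 := sub_ne_zero.2 hs1
  have hG : Complex.Gamma s ≠ 0 := Complex.Gamma_ne_zero_of_re_pos (by linarith)
  unfold epsteinEntire
  rw [dslope_of_ne _ hs1, slope_def_field, Complex.Gamma_add_one s hs0, Complex.Gamma_one,
    Complex.cpow_one]
  field_simp
  ring

/-- Analytic continuation of the Epstein zeta function of a positive definite binary quadratic
form, with its value at `-1`. -/
theorem exists_entire_hasSum_latticeForm (hA : 0 < A) (hδ : 0 < δ) (h : 4 * A * C - B ^ 2 = δ) :
    ∃ E : ℂ → ℂ, Differentiable ℂ E ∧ E (-1) = ((2 * π / √δ : ℝ) : ℂ) / 2 ∧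
      ∀ s : ℂ, 1 < s.re →
        HasSum (fun v : ℤ × ℤ => if v = 0 then 0 else 1 / ((latticeForm A B C v : ℝ) : ℂ) ^ s)
          (E s + ((2 * π / √δ : ℝ) : ℂ) / (s - 1)) := by
  have hpi := Real.pi_pos
  set c := 2 * π / √δ with hc
  set m := √δ / 2 with hm
  have hsd : 0 < √δ := Real.sqrt_pos.2 hδ
  have hm0 : 0 < m := by positivity
  have hc0 : 0 < c := by positivity
  have hmm : m ^ 2 = δ / 4 := by rw [hm, div_pow, Real.sq_sqrt hδ.le]; norm_num
  have hA' : 0 < A / m := by positivity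
  have h' : 4 * (A / m) * (C / m) - (B / m) ^ 2 = 4 := by
    field_simp
    rw [h, hmm]
    ring
  have hform : ∀ v, π * latticeForm (A / m) (B / m) (C / m) v = c * latticeForm A B C v := by
    intro v
    simp only [latticeForm, hc, hm]
    field_simp
  have hpos : ∀ v : ℤ × ℤ, v ≠ 0 → 0 < latticeForm A B C v := fun v hv => by
    have h1 := (inv_pos.2 (latticeForm_trace_pos hA' h')).trans_le (latticeForm_pos hA' h' hv)
    have h2 := mul_pos hpi h1
    rw [hform] at h2
    exact pos_of_mul_pos_right h2 hc0.le
  refine ⟨epsteinEntire c (latticeFEPair _ _ _ hA' h').Λ₀, differentiable_epsteinEntire hc0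
    (WeakFEPair.differentiable_Λ₀ _), epsteinEntire_neg_one _, fun s hs => ?_⟩
  rw [epsteinEntire_add _ hs]
  have hG : Complex.Gamma s ≠ 0 := Complex.Gamma_ne_zero_of_re_pos (by linarith)
  refine ((hasSum_latticeForm_cpow_aux hA' h' hs).mul_left _).congr_fun fun v => ?_
  split_ifs with hv
  · simp
  · have hc' : (c : ℂ) ^ s ≠ 0 := by
      rw [Complex.cpow_def_of_ne_zero (by exact_mod_cast hc0.ne')]
      exact Complex.exp_ne_zero _
    have hq' : ((latticeForm A B C v : ℝ) : ℂ) ^ s ≠ 0 := by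
      rw [Complex.cpow_def_of_ne_zero (by exact_mod_cast (hpos v hv).ne')]
      exact Complex.exp_ne_zero _
    rw [hform, Complex.ofReal_mul, Complex.mul_cpow_ofReal_nonneg hc0.le (hpos v hv).le]
    field_simp

end

end

/-- The polynomial `X² - v X - u` has negative fundamental discriminant. -/
class NegFundamental (u v : ℤ) : Prop where
  neg : v ^ 2 + 4 * u < 0
  isUnit_of_sq_mul : ∀ f e : ℤ, v ^ 2 + 4 * u = f ^ 2 * e → (e % 4 = 0 ∨ e % 4 = 1) → IsUnit f

namespace QuadOrder

variable (u v : ℤ)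

/-- The quadratic order with basis `1, ω` where `ω² = u + v ω`. -/
abbrev IntRing := QuadraticAlgebra ℤ u v

/-- The quadratic field containing `QuadOrder.IntRing`. -/
abbrev Frac := QuadraticAlgebra ℚ (u : ℚ) (v : ℚ)

/-- The inclusion of the quadratic order in its field of fractions. -/
def toFrac : IntRing u v →+* Frac u v where
  toFun z := ⟨z.re, z.im⟩
  map_one' := by ext <;> simp [QuadraticAlgebra.re_one, QuadraticAlgebra.im_one]
  map_mul' z w := by ext <;> simp
  map_zero' := by ext <;> simp
  map_add' z w := by ext <;> simp

theorem toFrac_injective : Function.Injective (toFrac u v) := fun z w h => by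
  ext
  · exact Int.cast_injective (α := ℚ) (congrArg QuadraticAlgebra.re h)
  · exact Int.cast_injective (α := ℚ) (congrArg QuadraticAlgebra.im h)

theorem exists_coord_of_trace_norm {T M : ℤ} {x y : ℚ}
    (hf : ∀ f e : ℤ, v ^ 2 + 4 * u = f ^ 2 * e → (e % 4 = 0 ∨ e % 4 = 1) → IsUnit f)
    (hT : 2 * x + v * y = T) (hM : x ^ 2 + v * x * y - u * y ^ 2 = M) :
    ∃ m n : ℤ, (m : ℚ) = x ∧ (n : ℚ) = y := by
  have h1 : ((v : ℚ) ^ 2 + 4 * u) * y ^ 2 = T ^ 2 - 4 * M := by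
    rw [← hT, ← hM]; ring
  have hy : (y.num : ℚ) / y.den = y := Rat.num_div_den y
  have hden : (y.den : ℚ) ≠ 0 := by exact_mod_cast y.den_nz
  have h2 : (v ^ 2 + 4 * u) * y.num ^ 2 = (T ^ 2 - 4 * M) * (y.den : ℤ) ^ 2 := by
    have : ((v : ℚ) ^ 2 + 4 * u) * y.num ^ 2 = (T ^ 2 - 4 * M) * (y.den : ℚ) ^ 2 := by
      have hyn : (y.num : ℚ) = y * y.den := (div_eq_iff hden).1 hy
      rw [← h1, hyn]
      ring
    exact_mod_cast this
  have hcop : IsCoprime ((y.den : ℤ) ^ 2) (y.num ^ 2) := by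
    refine IsCoprime.pow ?_
    rw [Int.isCoprime_iff_gcd_eq_one, Int.gcd_comm]
    exact y.reduced
  obtain ⟨e, he⟩ : (y.den : ℤ) ^ 2 ∣ v ^ 2 + 4 * u :=
    hcop.dvd_of_dvd_mul_right ⟨T ^ 2 - 4 * M, by rw [h2]; ring⟩
  have hden' : (y.den : ℤ) ^ 2 ≠ 0 := pow_ne_zero _ (by exact_mod_cast y.den_nz)
  have h3 : e * y.num ^ 2 = T ^ 2 - 4 * M := by
    rw [he] at h2
    exact mul_left_cancel₀ hden' (by linarith)
  have hsq : ∀ w : ℤ, w ^ 2 % 4 = 0 ∧ w % 2 = 0 ∨ w ^ 2 % 4 = 1 ∧ w % 2 = 1 := by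
    intro w
    rcases Int.emod_two_eq_zero_or_one w with h | h
    · obtain ⟨k, rfl⟩ : ∃ k, w = 2 * k := ⟨w / 2, by omega⟩
      left; refine ⟨?_, h⟩; ring_nf; omega
    · obtain ⟨k, rfl⟩ : ∃ k, w = 2 * k + 1 := ⟨w / 2, by omega⟩
      right; refine ⟨?_, h⟩; ring_nf; omega
  have he4 : e % 4 = 0 ∨ e % 4 = 1 := by
    have hmul : (e * y.num ^ 2) % 4 = (e % 4) * (y.num ^ 2 % 4) % 4 := Int.mul_emod _ _ _
    have hmul2 : ((y.den : ℤ) ^ 2 * e) % 4 = ((y.den : ℤ) ^ 2 % 4) * (e % 4) % 4 :=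
      Int.mul_emod _ _ _
    have e5 : e % 4 = 0 ∨ e % 4 = 1 ∨ e % 4 = 2 ∨ e % 4 = 3 := by omega
    rcases hsq y.num with ⟨a1, b1⟩ | ⟨a1, -⟩
    · rcases hsq y.den with ⟨a2, b2⟩ | ⟨a2, -⟩
      · exfalso
        have : Int.gcd y.num y.den = 1 := y.reduced
        have h22 : (2 : ℤ) ∣ Int.gcd y.num y.den := Int.dvd_coe_gcd (by omega) (by omega)
        rw [this] at h22
        omega
      · rw [a2] at hmul2
        rcases hsq v with ⟨a3, -⟩ | ⟨a3, -⟩ <;> omega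
    · rw [a1] at hmul
      rcases hsq T with ⟨a3, -⟩ | ⟨a3, -⟩ <;> omega
  have hu := hf y.den e he he4
  have hden1 : y.den = 1 := by
    rcases Int.isUnit_iff.1 hu with h | h <;> omega
  have hyn : (y.num : ℚ) = y := by
    rw [← hy, hden1]; simp
  rw [hden1] at he
  have hev : e = v ^ 2 + 4 * u := by rw [he]; simp
  have hpar : (T - v * y.num) % 2 = 0 := by
    have h4 : T ^ 2 % 4 = (v * y.num) ^ 2 % 4 := by
      have : T ^ 2 = (v * y.num) ^ 2 + 4 * (M + u * y.num ^ 2) := by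
        rw [hev] at h3; linarith
      rw [this]; omega
    rcases hsq T with ⟨a1, b1⟩ | ⟨a1, b1⟩ <;>
      rcases hsq (v * y.num) with ⟨a2, b2⟩ | ⟨a2, b2⟩ <;> omega
  refine ⟨(T - v * y.num) / 2, y.num, ?_, hyn⟩
  have : ((T - v * y.num) / 2 * 2 : ℤ) = T - v * y.num := by omega
  have h6 : (((T - v * y.num) / 2 : ℤ) : ℚ) * 2 = T - v * y.num := by exact_mod_cast this
  rw [hyn] at h6
  linarith

theorem isIntegral_ring (z : IntRing u v) : IsIntegral ℤ z := Algebra.IsIntegral.isIntegral z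

theorem algebra_norm_eq (z : IntRing u v) : Algebra.norm ℤ z = z.norm := by
  rw [Algebra.norm_apply, ← QuadraticAlgebra.det_toLinearMap_eq_norm]
  rfl

theorem four_mul_norm (z : IntRing u v) :
    4 * z.norm = (2 * z.re + v * z.im) ^ 2 - (v ^ 2 + 4 * u) * z.im ^ 2 := by
  rw [QuadraticAlgebra.norm_def]; ring

variable [NegFundamental u v]

instance : Fact (∀ r : ℚ, r ^ 2 ≠ (u : ℚ) + (v : ℚ) * r) where
  out r hr := by
    have h : ((v : ℚ) ^ 2 + 4 * u) < 0 := by exact_mod_cast NegFundamental.neg (u := u) (v := v)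
    nlinarith [sq_nonneg (2 * r - v)]

instance : IsDomain (IntRing u v) := (toFrac_injective u v).isDomain

noncomputable instance : Algebra (IntRing u v) (Frac u v) := (toFrac u v).toAlgebra

theorem isIntegral_algebraMap_rat {q : ℚ} (h : IsIntegral ℤ (⟨q, 0⟩ : Frac u v)) :
    ∃ n : ℤ, (n : ℚ) = q := by
  have h' : IsIntegral ℤ (algebraMap ℚ (Frac u v) q) := h
  rw [isIntegral_algebraMap_iff (FaithfulSMul.algebraMap_injective ℚ (Frac u v))] at h'
  exact IsIntegrallyClosed.isIntegral_iff.1 h'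

instance : IsScalarTower ℤ (IntRing u v) (Frac u v) := inferInstance

instance isIntegralClosure : IsIntegralClosure (IntRing u v) ℤ (Frac u v) where
  algebraMap_injective := toFrac_injective u v
  isIntegral_iff {z} := by
    constructor
    · intro hz
      have hs : IsIntegral ℤ (star z) :=
        hz.map (starRingEnd (Frac u v)).toIntAlgHom
      have h1 : IsIntegral ℤ (⟨2 * z.re + v * z.im, 0⟩ : Frac u v) := by
        have e : (⟨2 * z.re + v * z.im, 0⟩ : Frac u v) = z + star z := by
          ext
          · simp; ring
          · simp
        rw [e]
        exact hz.add hs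
      have h2 : IsIntegral ℤ (⟨z.re ^ 2 + v * z.re * z.im - u * z.im ^ 2, 0⟩ : Frac u v) := by
        have e : (⟨z.re ^ 2 + v * z.re * z.im - u * z.im ^ 2, 0⟩ : Frac u v) = z * star z := by
          rw [← QuadraticAlgebra.algebraMap_norm_eq_mul_star, QuadraticAlgebra.norm_def]
          ext
          · simp; ring
          · simp
        rw [e]
        exact hz.mul hs
      obtain ⟨T, hT⟩ := isIntegral_algebraMap_rat u v h1
      obtain ⟨M, hM⟩ := isIntegral_algebraMap_rat u v h2
      obtain ⟨m, n, hm, hn⟩ := exists_coord_of_trace_norm u v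
        NegFundamental.isUnit_of_sq_mul hT.symm hM.symm
      exact ⟨⟨m, n⟩, by ext; exacts [hm, hn]⟩
    · rintro ⟨y, rfl⟩
      exact (isIntegral_ring u v y).map (toFrac u v).toIntAlgHom

instance : IsDedekindDomain (IntRing u v) :=
  IsIntegralClosure.isDedekindDomain ℤ ℚ (Frac u v) (IntRing u v)

noncomputable instance : Fintype (ClassGroup (IntRing u v)) :=
  ClassGroup.fintypeOfAdmissibleOfFinite ℚ (Frac u v) AbsoluteValue.absIsAdmissible

theorem norm_pos {z : IntRing u v} (hz : z ≠ 0) : 0 < z.norm := by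
  have hneg := NegFundamental.neg (u := u) (v := v)
  have h := four_mul_norm u v z
  by_contra! hc
  apply hz
  have him : z.im = 0 := by
    by_contra h0
    have := sq_pos_of_ne_zero h0
    nlinarith [sq_nonneg (2 * z.re + v * z.im)]
  have hre : z.re = 0 := by
    rw [him] at h
    nlinarith [sq_nonneg z.re]
  ext
  · exact hre
  · exact him

end QuadOrder

section

open scoped ComplexOrder

namespace IdealCount

variable {R : Type*} [CommRing R] [IsDedekindDomain R]

open Classical in
/-- The class of an ideal, written additively (and `0` for the zero ideal). -/
noncomputable def cls (I : Ideal R) : Additive (ClassGroup R) :=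
  if h : I = 0 then 0 else Additive.ofMul (ClassGroup.mk0 ⟨I, mem_nonZeroDivisors_of_ne_zero h⟩)

theorem cls_of_ne_zero {I : Ideal R} (h : I ≠ 0) :
    cls I = Additive.ofMul (ClassGroup.mk0 ⟨I, mem_nonZeroDivisors_of_ne_zero h⟩) := dif_neg h

theorem cls_mul {I J : Ideal R} (hI : I ≠ 0) (hJ : J ≠ 0) : cls (I * J) = cls I + cls J := by
  rw [cls_of_ne_zero hI, cls_of_ne_zero hJ, cls_of_ne_zero (mul_ne_zero hI hJ), ← ofMul_mul,
    ← map_mul]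
  rfl

theorem cls_one : cls (1 : Ideal R) = 0 := by
  have := cls_mul (one_ne_zero (α := Ideal R)) one_ne_zero
  simpa using this

theorem cls_pow {I : Ideal R} (hI : I ≠ 0) (k : ℕ) : cls (I ^ k) = k • cls I := by
  induction k with
  | zero => rw [pow_zero, zero_nsmul, cls_one]
  | succ k ih => rw [pow_succ, cls_mul (pow_ne_zero k hI) hI, ih, succ_nsmul]

theorem cls_eq_zero_iff {I : Ideal R} (hI : I ≠ 0) :
    cls I = 0 ↔ ∃ x : R, x ≠ 0 ∧ I = Ideal.span {x} := by
  rw [cls_of_ne_zero hI, ofMul_eq_zero, ClassGroup.mk0_eq_one_iff]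
  constructor
  · rintro ⟨x, hx⟩
    refine ⟨x, ?_, hx⟩
    rintro rfl
    exact hI (by simpa using hx)
  · rintro ⟨x, -, hx⟩
    exact ⟨x, hx⟩

theorem exists_cls_eq (g : Additive (ClassGroup R)) : ∃ I : Ideal R, I ≠ 0 ∧ cls I = g := by
  obtain ⟨I, hI⟩ := ClassGroup.mk0_surjective g.toMul
  have h0 : (I : Ideal R) ≠ 0 := nonZeroDivisors.ne_zero I.2
  exact ⟨I, h0, by rw [cls_of_ne_zero h0]; exact congrArg Additive.ofMul hI⟩

variable [Module.Free ℤ R] [Module.Finite ℤ R] [CharZero R]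

variable (R) in
theorem finite_ideals (g : Additive (ClassGroup R)) (n : ℕ) :
    {I : Ideal R | I ≠ 0 ∧ Ideal.absNorm I = n ∧ cls I = g}.Finite :=
  (Ideal.finite_setOfPred_absNorm_eq n).subset fun _ h => h.2.1

/-- The nonzero ideals of norm `n` in the class `g`. -/
noncomputable def ideals (g : Additive (ClassGroup R)) (n : ℕ) : Finset (Ideal R) :=
  (finite_ideals R g n).toFinset

@[simp]
theorem mem_ideals {g : Additive (ClassGroup R)} {n : ℕ} {I : Ideal R} :
    I ∈ ideals g n ↔ I ≠ 0 ∧ Ideal.absNorm I = n ∧ cls I = g := by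
  simp [ideals]

theorem absNorm_ne_zero {I : Ideal R} (h : I ≠ 0) : Ideal.absNorm I ≠ 0 := fun h0 =>
  h (Ideal.absNorm_eq_zero_iff.1 h0)

theorem one_lt_absNorm {P : Ideal R} (h : Prime P) : 1 < Ideal.absNorm P := by
  have h0 := absNorm_ne_zero h.ne_zero
  have h1 : Ideal.absNorm P ≠ 1 := fun h1 => h.not_isUnit (by
    rw [Ideal.absNorm_eq_one_iff] at h1
    rw [h1, ← Ideal.one_eq_top]; exact isUnit_one)
  omega

variable (R) in
theorem finite_primePowers (g : Additive (ClassGroup R)) (n : ℕ) :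
    {x : Ideal R × ℕ | Prime x.1 ∧ Ideal.absNorm x.1 ^ (x.2 + 1) = n ∧
      (x.2 + 1) • cls x.1 = g}.Finite := by
  refine ((Ideal.finite_setOfPred_absNorm_le n).prod (Set.finite_Iic n)).subset ?_
  rintro ⟨P, k⟩ ⟨hP, hn, -⟩
  have h1 := one_lt_absNorm hP
  refine ⟨?_, ?_⟩
  · change Ideal.absNorm P ≤ n
    rw [← hn]
    exact Nat.le_self_pow (Nat.succ_ne_zero k) _
  · change k ≤ n
    have : k + 1 < Ideal.absNorm P ^ (k + 1) := Nat.lt_pow_self h1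
    change Ideal.absNorm P ^ (k + 1) = n at hn
    omega

/-- The prime powers `P ^ (k + 1)` of norm `n` in the class `g`, recorded as pairs `(P, k)`. -/
noncomputable def primePowers (g : Additive (ClassGroup R)) (n : ℕ) : Finset (Ideal R × ℕ) :=
  (finite_primePowers R g n).toFinset

@[simp]
theorem mem_primePowers {g : Additive (ClassGroup R)} {n : ℕ} {x : Ideal R × ℕ} :
    x ∈ primePowers g n ↔ Prime x.1 ∧ Ideal.absNorm x.1 ^ (x.2 + 1) = n ∧
      (x.2 + 1) • cls x.1 = g := by
  simp [primePowers]

/-- The number of ideals of norm `n` in the class `g`. -/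
noncomputable def count (g : Additive (ClassGroup R)) : ArithmeticFunction ℂ where
  toFun n := ((ideals g n).card : ℂ)
  map_zero' := by
    rw [Nat.cast_eq_zero, Finset.card_eq_zero, Finset.eq_empty_iff_forall_notMem]
    intro I hI
    rw [mem_ideals] at hI
    exact absNorm_ne_zero hI.1 hI.2.1

/-- The von Mangoldt function of the ideals in the class `g`. -/
noncomputable def mangoldt (g : Additive (ClassGroup R)) : ArithmeticFunction ℂ where
  toFun n := ((∑ x ∈ primePowers g n, Real.log (Ideal.absNorm x.1) : ℝ) : ℂ)
  map_zero' := by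
    rw [Finset.sum_eq_zero, Complex.ofReal_zero]
    intro x hx
    rw [mem_primePowers] at hx
    exact absurd hx.2.1 (pow_ne_zero _ (absNorm_ne_zero hx.1.ne_zero))

theorem count_apply (g : Additive (ClassGroup R)) (n : ℕ) :
    count g n = ((ideals g n).card : ℂ) := rfl

theorem mangoldt_apply (g : Additive (ClassGroup R)) (n : ℕ) :
    mangoldt g n = ((∑ x ∈ primePowers g n, Real.log (Ideal.absNorm x.1) : ℝ) : ℂ) := rfl

open UniqueFactorizationMonoid in
theorem lt_count_iff [DecidableEq (Ideal R)] {I P : Ideal R} (hI : I ≠ 0) (hP : Prime P) (k : ℕ) :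
    k < (normalizedFactors I).count P ↔ P ^ (k + 1) ∣ I := by
  rw [pow_dvd_iff_le_emultiplicity,
    le_emultiplicity_iff_replicate_le_normalizedFactors hP.irreducible hI, normalize_eq,
    ← Multiset.le_count_iff_replicate_le, Nat.succ_le_iff]

variable (R) in
open UniqueFactorizationMonoid in
/-- The pairs `(P, k)` such that the prime power `P ^ (k + 1)` divides `I`. -/
noncomputable def divisors (I : Ideal R) : Finset (Σ _ : Ideal R, ℕ) := by
  classical
  exact (normalizedFactors I).toFinset.sigma fun P => Finset.range ((normalizedFactors I).count P)

open UniqueFactorizationMonoid in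
theorem mem_divisors {I : Ideal R} (hI : I ≠ 0) {x : Σ _ : Ideal R, ℕ} :
    x ∈ divisors R I ↔ Prime x.1 ∧ x.1 ^ (x.2 + 1) ∣ I := by
  classical
  obtain ⟨P, k⟩ := x
  simp only [divisors, Finset.mem_sigma, Multiset.mem_toFinset, Finset.mem_range]
  constructor
  · rintro ⟨h1, h2⟩
    have hP := prime_of_normalized_factor P h1
    exact ⟨hP, (lt_count_iff hI hP k).1 h2⟩
  · rintro ⟨hP, h⟩
    have h2 := (lt_count_iff hI hP k).2 h
    exact ⟨Multiset.count_pos.1 (by omega), h2⟩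

open UniqueFactorizationMonoid in
theorem log_absNorm {I : Ideal R} (hI : I ≠ 0) :
    Real.log (Ideal.absNorm I) = ∑ x ∈ divisors R I, Real.log (Ideal.absNorm x.1) := by
  classical
  have h1 : (normalizedFactors I).prod = I := by
    have := prod_normalizedFactors (a := I) hI
    rwa [associated_iff_eq] at this
  have h2 : ∀ m : Multiset (Ideal R), (∀ P ∈ m, P ≠ 0) →
      Real.log (Ideal.absNorm m.prod) = (m.map fun P => Real.log (Ideal.absNorm P)).sum := by
    intro m
    induction m using Multiset.induction_on with
    | empty => simp
    | cons P m ih =>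
        intro h
        have hP : Ideal.absNorm P ≠ 0 := absNorm_ne_zero (h P (Multiset.mem_cons_self P m))
        have hm : Ideal.absNorm m.prod ≠ 0 := absNorm_ne_zero <|
          Multiset.prod_ne_zero fun h0 => h 0 (Multiset.mem_cons_of_mem h0) rfl
        rw [Multiset.prod_cons, map_mul, Nat.cast_mul, Real.log_mul (by exact_mod_cast hP)
          (by exact_mod_cast hm), Multiset.map_cons, Multiset.sum_cons,
          ih fun Q hQ => h Q (Multiset.mem_cons_of_mem hQ)]
  conv_lhs => rw [← h1]
  rw [h2 _ fun P hP => (prime_of_normalized_factor P hP).ne_zero,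
    Finset.sum_multiset_map_count, divisors, Finset.sum_sigma]
  simp

theorem count_mul_log [Fintype (ClassGroup R)] (g : Additive (ClassGroup R)) (n : ℕ) :
    count g n * Real.log n =
      ∑ h : Additive (ClassGroup R), (count (g - h) * mangoldt h) n := by
  have hl : count g n * Real.log n =
      ((∑ y ∈ (ideals g n).sigma fun I => divisors R I, Real.log (Ideal.absNorm y.2.1) : ℝ) : ℂ) := by
    rw [Finset.sum_sigma, count_apply, ← nsmul_eq_mul, ← Complex.ofReal_nsmul]
    congr 1
    rw [← Finset.sum_const]
    refine Finset.sum_congr rfl fun I hI => ?_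
    rw [mem_ideals] at hI
    rw [← log_absNorm hI.1, hI.2.1]
  have hr : ∑ h : Additive (ClassGroup R), (count (g - h) * mangoldt h) n =
      ((∑ y ∈ (Finset.univ : Finset (Additive (ClassGroup R))).sigma fun h =>
        n.divisorsAntidiagonal.sigma fun d => (ideals (g - h) d.1).sigma fun _ => primePowers h d.2,
        Real.log (Ideal.absNorm y.2.2.2.1) : ℝ) : ℂ) := by
    simp only [Finset.sum_sigma, ArithmeticFunction.mul_apply, count_apply, mangoldt_apply,
      Finset.sum_const, nsmul_eq_mul]
    push_cast
    rfl
  rw [hl, hr]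
  congr 1
  symm
  refine Finset.sum_nbij
    (fun y => ⟨y.2.2.1 * y.2.2.2.1 ^ (y.2.2.2.2 + 1), ⟨y.2.2.2.1, y.2.2.2.2⟩⟩) ?_ ?_ ?_ ?_
  · rintro ⟨h, ⟨i, j⟩, J, P, k⟩ hy
    simp only [Finset.mem_sigma, Finset.mem_univ, true_and, Nat.mem_divisorsAntidiagonal,
      mem_ideals, mem_primePowers] at hy ⊢
    obtain ⟨⟨hij, hn⟩, ⟨hJ, hJi, hJc⟩, hP, hPj, hPc⟩ := hy
    have hPk := pow_ne_zero (k + 1) hP.ne_zero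
    have hI := mul_ne_zero hJ hPk
    rw [mem_divisors hI]
    refine ⟨⟨hI, ?_, ?_⟩, hP, dvd_mul_left _ _⟩
    · rw [map_mul, map_pow, hJi, hPj, hij]
    · rw [cls_mul hJ hPk, hJc, cls_pow hP.ne_zero, hPc, sub_add_cancel]
  · rintro ⟨h, ⟨i, j⟩, J, P, k⟩ hy ⟨h', ⟨i', j'⟩, J', P', k'⟩ hy' he
    simp only [Finset.mem_coe, Finset.mem_sigma, Finset.mem_univ, true_and,
      Nat.mem_divisorsAntidiagonal, mem_ideals, mem_primePowers] at hy hy'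
    obtain ⟨-, ⟨hJ, rfl, -⟩, hP, rfl, rfl⟩ := hy
    obtain ⟨-, ⟨hJ', rfl, -⟩, hP', rfl, rfl⟩ := hy'
    simp only [Sigma.mk.injEq, heq_eq_eq] at he
    obtain ⟨he, rfl, rfl⟩ := he
    obtain rfl := mul_right_cancel₀ (pow_ne_zero _ hP.ne_zero) he
    rfl
  · rintro ⟨I, P, k⟩ hy
    simp only [Finset.mem_coe, Finset.mem_sigma, mem_ideals] at hy
    obtain ⟨⟨hI, hIn, hIc⟩, hd⟩ := hy
    rw [mem_divisors hI] at hd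
    obtain ⟨hP, J, hJ⟩ := hd
    simp only at hJ hP
    have hJ0 : J ≠ 0 := by rintro rfl; exact hI (by rw [hJ, mul_zero])
    have hPk := pow_ne_zero (k + 1) hP.ne_zero
    refine ⟨⟨(k + 1) • cls P, ⟨Ideal.absNorm J, Ideal.absNorm P ^ (k + 1)⟩, J, P, k⟩, ?_, ?_⟩
    · simp only [Finset.mem_coe, Finset.mem_sigma, Finset.mem_univ, true_and,
        Nat.mem_divisorsAntidiagonal, mem_ideals, mem_primePowers, and_true]
      refine ⟨⟨?_, ?_⟩, ⟨hJ0, ?_⟩, hP⟩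
      · rw [← hIn, hJ, map_mul, map_pow, mul_comm]
      · rw [← hIn]; exact absNorm_ne_zero hI
      · rw [← hIc, hJ, cls_mul hPk hJ0, cls_pow hP.ne_zero]; abel
    · simp only [Sigma.mk.injEq, heq_eq_eq, and_true]
      rw [hJ, mul_comm]
  · intro y _
    rfl

theorem count_nonneg (g : Additive (ClassGroup R)) (n : ℕ) : 0 ≤ count g n := by
  rw [count_apply]; exact Nat.cast_nonneg _

theorem mangoldt_nonneg (g : Additive (ClassGroup R)) (n : ℕ) : 0 ≤ mangoldt g n := by
  rw [mangoldt_apply]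
  exact_mod_cast Finset.sum_nonneg fun x _ => Real.log_natCast_nonneg _

theorem ideals_one (g : Additive (ClassGroup R)) {I : Ideal R} (h : I ∈ ideals g 1) :
    I = 1 ∧ g = 0 := by
  rw [mem_ideals] at h
  have h1 : I = 1 := by rw [Ideal.one_eq_top]; exact Ideal.absNorm_eq_one_iff.1 h.2.1
  refine ⟨h1, ?_⟩
  rw [← h.2.2, h1, cls_one]

theorem count_zero_one : count (0 : Additive (ClassGroup R)) 1 = 1 := by
  rw [count_apply, Nat.cast_eq_one, Finset.card_eq_one]
  refine ⟨1, ?_⟩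
  ext I
  rw [Finset.mem_singleton]
  refine ⟨fun h => (ideals_one 0 h).1, ?_⟩
  rintro rfl
  rw [mem_ideals]
  exact ⟨one_ne_zero, by rw [map_one], cls_one⟩

theorem count_one {g : Additive (ClassGroup R)} (hg : g ≠ 0) : count g 1 = 0 := by
  rw [count_apply, Nat.cast_eq_zero, Finset.card_eq_zero, Finset.eq_empty_iff_forall_notMem]
  exact fun I hI => hg (ideals_one g hI).2

end IdealCount

end

namespace IdealCount

variable {R : Type*} [CommRing R] [IsDedekindDomain R]

/-- Nonzero elements of an ideal `B` correspond to pairs of an ideal in the inverse class of `B`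
and a unit. -/
theorem exists_element_param {B : Ideal R} (hB : B ≠ 0) :
    ∃ ψ : {I : Ideal R // I ≠ 0 ∧ cls I = -cls B} × Rˣ → R, Function.Injective ψ ∧
      (∀ x, ψ x ≠ 0 ∧ Ideal.span {ψ x} = B * x.1) ∧
      (∀ x, ψ x ∈ B) ∧ ∀ z ∈ B, z ≠ 0 → ∃ x, ψ x = z := by
  have hgen : ∀ I : {I : Ideal R // I ≠ 0 ∧ cls I = -cls B},
      ∃ x : R, x ≠ 0 ∧ B * I = Ideal.span {x} := fun ⟨I, hI, hc⟩ => by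
    rw [← cls_eq_zero_iff (mul_ne_zero hB hI), cls_mul hB hI, hc, add_neg_cancel]
  choose gen hgen0 hgen using hgen
  have hspan : ∀ x : {I : Ideal R // I ≠ 0 ∧ cls I = -cls B} × Rˣ,
      Ideal.span {(x.2 : R) * gen x.1} = B * x.1 := fun ⟨I, ε⟩ => by
    rw [hgen, Ideal.span_singleton_eq_span_singleton]
    exact associated_unit_mul_left _ _ ε.isUnit
  refine ⟨fun x => x.2 * gen x.1, ?_, fun x => ⟨?_, hspan x⟩, fun x => ?_, ?_⟩
  · rintro ⟨I, ε⟩ ⟨I', ε'⟩ h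
    have h1 := hspan (I, ε)
    have h2 := hspan (I', ε')
    simp only at h h1 h2
    rw [h, h2] at h1
    obtain rfl : I = I' := Subtype.ext (mul_left_cancel₀ hB h1).symm
    have := mul_right_cancel₀ (hgen0 I) h
    rw [Units.ext this]
  · exact mul_ne_zero x.2.ne_zero (hgen0 x.1)
  · exact (Ideal.span_singleton_le_iff_mem B).1 ((hspan x).trans_le Ideal.mul_le_left)
  · intro z hz hz0
    have hdvd : B ∣ Ideal.span {z} := Ideal.dvd_iff_le.2 ((Ideal.span_singleton_le_iff_mem B).2 hz)
    obtain ⟨I, hI⟩ := hdvd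
    have hs : Ideal.span {z} ≠ 0 := by simpa using hz0
    have hI0 : I ≠ 0 := by rintro rfl; exact hs (by rw [hI, mul_zero])
    have hc : cls I = -cls B := by
      rw [eq_neg_iff_add_eq_zero, add_comm, ← cls_mul hB hI0, ← hI, cls_eq_zero_iff hs]
      exact ⟨z, hz0, rfl⟩
    have h1 := hgen ⟨I, hI0, hc⟩
    rw [← hI, Ideal.span_singleton_eq_span_singleton] at h1
    obtain ⟨ε, hε⟩ := h1.symm
    exact ⟨⟨⟨I, hI0, hc⟩, ε⟩, by rw [← hε, mul_comm]⟩

end IdealCount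

namespace QuadOrder

variable (u v : ℤ) [NegFundamental u v]

theorem exists_latticeForm_eq_norm {I : Ideal (IntRing u v)} (hI : I ≠ 0) :
    ∃ A B C : ℝ, 0 < A ∧ 4 * A * C - B ^ 2 = (-(v ^ 2 + 4 * u) : ℤ) ∧
      ∃ θ : ℤ × ℤ → IntRing u v, Function.Injective θ ∧ θ 0 = 0 ∧ (∀ x, θ x ∈ I) ∧
        (∀ z ∈ I, ∃ x, θ x = z) ∧
        ∀ x, latticeForm A B C x = (θ x).norm / (Ideal.absNorm I : ℝ) := by
  have hn : (Ideal.absNorm I : ℝ) ≠ 0 := by exact_mod_cast IdealCount.absNorm_ne_zero hI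
  have hnpos : (0 : ℝ) < Ideal.absNorm I := by positivity
  let b := QuadraticAlgebra.basis u v
  let e := Ideal.selfBasis b I hI
  have hdet := Ideal.natAbs_det_basis_change b I e
  set e0 : IntRing u v := Subtype.val (e 0) with he0
  set e1 : IntRing u v := Subtype.val (e 1) with he1
  have hdet' : b.det (((↑) : I → IntRing u v) ∘ e) = e0.re * e1.im - e1.re * e0.im := by
    rw [Module.Basis.det_apply, Matrix.det_fin_two]
    simp [Module.Basis.toMatrix_apply, b, QuadraticAlgebra.basis_repr_apply, e0, e1]
  have hsq : (e0.re * e1.im - e1.re * e0.im) ^ 2 = (Ideal.absNorm I : ℤ) ^ 2 := by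
    rw [← hdet', ← hdet, Int.natCast_natAbs, sq_abs]
  have hsqR : ((e0.re : ℝ) * e1.im - e1.re * e0.im) ^ 2 = (Ideal.absNorm I : ℝ) ^ 2 := by
    exact_mod_cast hsq
  have he00 : e0 ≠ 0 := fun h => e.ne_zero 0 (Subtype.ext h)
  refine ⟨e0.norm / Ideal.absNorm I, ((2 * e0.re * e1.re + v * (e0.re * e1.im + e1.re * e0.im) -
    2 * u * e0.im * e1.im : ℤ) : ℝ) / Ideal.absNorm I, e1.norm / Ideal.absNorm I, ?_, ?_,
    fun x => x.1 • e0 + x.2 • e1, ?_, ?_, ?_, ?_, ?_⟩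
  · exact div_pos (by exact_mod_cast norm_pos u v he00) hnpos
  · field_simp
    rw [QuadraticAlgebra.norm_def, QuadraticAlgebra.norm_def]
    push_cast
    linear_combination (-(v ^ 2 + 4 * u) : ℝ) * hsqR
  · intro x y h
    have h1 : (e.equivFun.symm ![x.1, x.2]) = e.equivFun.symm ![y.1, y.2] := by
      apply Subtype.ext
      simpa [Module.Basis.equivFun_symm_apply, Fin.sum_univ_two] using h
    have h2 := e.equivFun.symm.injective h1
    ext
    · exact congrFun h2 0
    · exact congrFun h2 1
  · simp
  · intro x
    exact I.add_mem (zsmul_mem (e 0).2 _) (zsmul_mem (e 1).2 _)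
  · intro z hz
    refine ⟨(e.equivFun ⟨z, hz⟩ 0, e.equivFun ⟨z, hz⟩ 1), ?_⟩
    have := e.sum_equivFun ⟨z, hz⟩
    rw [Fin.sum_univ_two] at this
    simpa using congrArg Subtype.val this
  · rintro ⟨x, y⟩
    simp only [latticeForm, QuadraticAlgebra.norm_def]
    field_simp
    simp
    ring

end QuadOrder

section

open scoped Real

namespace QuadOrder

variable (u v : ℤ) [NegFundamental u v]

theorem absNorm_span {z : IntRing u v} :
    ((Ideal.absNorm (Ideal.span {z}) : ℕ) : ℤ) = z.norm := by
  rw [Ideal.absNorm_span_singleton, algebra_norm_eq, Int.natCast_natAbs, abs_of_nonneg]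
  rcases eq_or_ne z 0 with rfl | h
  · simp
  · exact (norm_pos u v h).le

/-- `2π / √|Δ|`, where `Δ` is the discriminant of the order. -/
noncomputable def latticeResidue : ℂ := ((2 * π / √((-(v ^ 2 + 4 * u) : ℤ) : ℝ) : ℝ) : ℂ)

theorem disc_pos : (0 : ℝ) < ((-(v ^ 2 + 4 * u) : ℤ) : ℝ) := by
  have := NegFundamental.neg (u := u) (v := v)
  exact_mod_cast (by linarith : 0 < -(v ^ 2 + 4 * u))

theorem latticeResidue_ne_zero : latticeResidue u v ≠ 0 := by
  have := disc_pos u v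
  rw [latticeResidue, Complex.ofReal_ne_zero]
  positivity

theorem hasSum_of_param {X : Type*} {A B C : ℝ} {s a : ℂ} {φ : X → ℤ × ℤ} {n : X → ℕ}
    (hφ : Function.Injective φ) (hφ0 : ∀ x, φ x ≠ 0) (hφs : ∀ w, w ≠ 0 → ∃ x, φ x = w)
    (hn : ∀ x, latticeForm A B C (φ x) = n x)
    (h : HasSum (fun v : ℤ × ℤ => if v = 0 then 0 else
      1 / ((latticeForm A B C v : ℝ) : ℂ) ^ s) a) :
    HasSum (fun x => 1 / (n x : ℂ) ^ s) a := by
  rw [← hφ.hasSum_iff] at h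
  · convert h using 2 with x
    rw [Function.comp_apply, if_neg (hφ0 x), hn, Complex.ofReal_natCast]
  · intro w hw
    rw [if_pos]
    by_contra h0
    exact hw (hφs w h0)

open IdealCount in
theorem exists_form_param (B : Ideal (IntRing u v)) (hB : B ≠ 0) :
    ∃ a b c : ℝ, 0 < a ∧ 4 * a * c - b ^ 2 = (-(v ^ 2 + 4 * u) : ℤ) ∧
    ∃ φ : {I : Ideal (IntRing u v) // I ≠ 0 ∧ cls I = -cls B} × (IntRing u v)ˣ → ℤ × ℤ,
      Function.Injective φ ∧ (∀ x, φ x ≠ 0) ∧ (∀ w, w ≠ 0 → ∃ x, φ x = w) ∧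
      ∀ x, latticeForm a b c (φ x) = Ideal.absNorm x.1.1 := by
  obtain ⟨ψ, hψ, hψ0, hmem, hψs⟩ := exists_element_param hB
  obtain ⟨a, b, c, ha, hd, θ, hθ, hθ0, hθm, hθs, hform⟩ := exists_latticeForm_eq_norm u v hB
  choose φ hφ using fun x => hθs (ψ x) (hmem x)
  refine ⟨a, b, c, ha, hd, φ, ?_, ?_, ?_, ?_⟩
  · exact fun x y h => hψ (by rw [← hφ, ← hφ, h])
  · exact fun x h => (hψ0 x).1 (by rw [← hφ, h, hθ0])
  · intro w h0
    have h1 : θ w ≠ 0 := fun h1 => h0 (hθ (by rw [h1, hθ0]))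
    obtain ⟨x, hx⟩ := hψs (θ w) (hθm w) h1
    exact ⟨x, hθ (by rw [hφ, hx])⟩
  · intro x
    have hBn : (Ideal.absNorm B : ℝ) ≠ 0 := by exact_mod_cast absNorm_ne_zero hB
    have h1 : ((Ideal.absNorm (Ideal.span {ψ x}) : ℕ) : ℝ) =
        (Ideal.absNorm B : ℝ) * Ideal.absNorm x.1.1 := by
      rw [(hψ0 x).2, map_mul, Nat.cast_mul]
    have h2 : (((ψ x).norm : ℤ) : ℝ) = ((Ideal.absNorm (Ideal.span {ψ x}) : ℕ) : ℝ) := by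
      rw [← absNorm_span, Int.cast_natCast]
    rw [hform, hφ, h2, h1, mul_div_cancel_left₀ _ hBn]

open IdealCount in
theorem exists_hasSum_elements (g : Additive (ClassGroup (IntRing u v))) :
    ∃ E : ℂ → ℂ, Differentiable ℂ E ∧ E (-1) = latticeResidue u v / 2 ∧ ∀ s : ℂ, 1 < s.re →
      HasSum (fun x : {I : Ideal (IntRing u v) // I ≠ 0 ∧ cls I = g} × (IntRing u v)ˣ =>
        1 / ((Ideal.absNorm x.1.1 : ℕ) : ℂ) ^ s) (E s + latticeResidue u v / (s - 1)) := by
  obtain ⟨B, hB, hBg⟩ := exists_cls_eq (-g)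
  obtain rfl : g = -cls B := by rw [hBg, neg_neg]
  obtain ⟨a, b, c, ha, hd, φ, hφ, hφ0, hφs, hn⟩ := exists_form_param u v B hB
  obtain ⟨E, hE, hE1, hEs⟩ := exists_entire_hasSum_latticeForm ha (disc_pos u v) hd
  exact ⟨E, hE, hE1, fun s hs => hasSum_of_param hφ hφ0 hφs hn (hEs s hs)⟩

open IdealCount in
theorem finite_units : Finite (IntRing u v)ˣ := by
  by_contra hinf
  rw [not_finite_iff_infinite] at hinf
  obtain ⟨E, -, -, hE⟩ := exists_hasSum_elements u v 0
  have h := (hE 2 (by simp)).summable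
  have h1 := h.comp_injective (i := fun ε : (IntRing u v)ˣ => (⟨⟨1, one_ne_zero, cls_one⟩, ε⟩ :
    {I : Ideal (IntRing u v) // I ≠ 0 ∧ cls I = 0} × (IntRing u v)ˣ))
    fun x y h => (Prod.mk.inj h).2
  simp only [Function.comp_def, map_one, summable_const_iff] at h1
  simp at h1

open IdealCount in
theorem exists_hasSum_count (g : Additive (ClassGroup (IntRing u v))) :
    ∃ E : ℂ → ℂ, Differentiable ℂ E ∧
      E (-1) = latticeResidue u v / Nat.card (IntRing u v)ˣ / 2 ∧ ∀ s : ℂ, 1 < s.re →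
      HasSum (fun n => LSeries.term (count g) s n)
        (E s + latticeResidue u v / Nat.card (IntRing u v)ˣ / (s - 1)) := by
  have hfin := finite_units u v
  have hw : (Nat.card (IntRing u v)ˣ : ℂ) ≠ 0 := by exact_mod_cast Nat.card_pos.ne'
  obtain ⟨E, hE, hE1, hEs⟩ := exists_hasSum_elements u v g
  refine ⟨fun s => E s / Nat.card (IntRing u v)ˣ, hE.div_const _, ?_, fun s hs => ?_⟩
  · simp only [hE1]; ring
  have h := ((hEs s hs).tsum_fiberwise fun x => Ideal.absNorm x.1.1).div_const
    (Nat.card (IntRing u v)ˣ : ℂ)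
  have hterm : (fun n => LSeries.term (count g) s n) = fun n =>
      (∑' b : ((fun x : {I : Ideal (IntRing u v) // I ≠ 0 ∧ cls I = g} × (IntRing u v)ˣ =>
        Ideal.absNorm x.1.1) ⁻¹' {n} : Set _), 1 / ((Ideal.absNorm b.1.1.1 : ℕ) : ℂ) ^ s) /
        Nat.card (IntRing u v)ˣ := by
    ext n
    have h1 : ∀ x : ((fun x : {I : Ideal (IntRing u v) // I ≠ 0 ∧ cls I = g} × (IntRing u v)ˣ =>
        Ideal.absNorm x.1.1) ⁻¹' {n} : Set _),
        1 / ((Ideal.absNorm x.1.1.1 : ℕ) : ℂ) ^ s = 1 / (n : ℂ) ^ s := fun x => by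
      rw [show Ideal.absNorm x.1.1.1 = n from x.2]
    rw [tsum_congr h1, tsum_const]
    let eqv : ((fun x : {I : Ideal (IntRing u v) // I ≠ 0 ∧ cls I = g} × (IntRing u v)ˣ =>
        Ideal.absNorm x.1.1) ⁻¹' {n} : Set _) ≃ ideals g n × (IntRing u v)ˣ :=
      { toFun x := (⟨x.1.1.1, mem_ideals.2 ⟨x.1.1.2.1, x.2, x.1.1.2.2⟩⟩, x.1.2)
        invFun y := ⟨(⟨y.1.1, (mem_ideals.1 y.1.2).1, (mem_ideals.1 y.1.2).2.2⟩, y.2),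
          (mem_ideals.1 y.1.2).2.1⟩
        left_inv x := rfl
        right_inv y := rfl }
    rw [Nat.card_congr eqv, Nat.card_prod, Nat.card_eq_fintype_card, Fintype.card_coe,
      nsmul_eq_mul]
    rcases eq_or_ne n 0 with rfl | hn
    · have := (count g).map_zero
      rw [count_apply] at this
      rw [LSeries.term_zero]
      push_cast
      rw [this]
      ring
    · rw [LSeries.term_of_ne_zero hn, count_apply]
      push_cast
      field_simp
  rw [hterm]
  rw [div_right_comm, ← add_div]
  exact h

end QuadOrder

end

section

open scoped ComplexOrder

namespace IdealCount

variable {R : Type*} [CommRing R] [IsDedekindDomain R] [Module.Free ℤ R] [Module.Finite ℤ R]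
  [CharZero R]

theorem exists_prime_mem {P : Ideal R} (hP : Prime P) :
    ∃ q f : ℕ, 0 < f ∧ q.Prime ∧ P.absNorm = q ^ f ∧ P ∣ Ideal.span {(q : R)} := by
  have hP' := Ideal.isPrime_of_prime hP
  have : P.IsMaximal := hP'.isMaximal hP.ne_zero
  obtain ⟨q, f, hf, hq, hqp, hqf⟩ := Ideal.exists_prime_and_absNorm_eq_pow P
  exact ⟨q, f, hf, hqp, hqf, Ideal.dvd_iff_le.2 ((Ideal.span_singleton_le_iff_mem P).2 hq)⟩

theorem sum_log_le (g : Additive (ClassGroup R)) (n : ℕ) :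
    ∑ x ∈ primePowers g n, Real.log (Ideal.absNorm x.1) ≤
      Module.finrank ℤ R * ArithmeticFunction.vonMangoldt n := by
  classical
  rcases (primePowers g n).eq_empty_or_nonempty with h | ⟨⟨P₀, k₀⟩, h₀⟩
  · rw [h, Finset.sum_empty]
    exact mul_nonneg (Nat.cast_nonneg _) ArithmeticFunction.vonMangoldt_nonneg
  obtain ⟨hP₀, hn₀, -⟩ := mem_primePowers.1 h₀
  obtain ⟨q, f, hf, hq, hN₀, -⟩ := exists_prime_mem hP₀
  simp only at hn₀
  have hn : n = q ^ (f * (k₀ + 1)) := by rw [← hn₀, hN₀, pow_mul]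
  have hΛ : ArithmeticFunction.vonMangoldt n = Real.log q := by
    rw [hn, ArithmeticFunction.vonMangoldt_apply_pow (by positivity),
      ArithmeticFunction.vonMangoldt_apply_prime hq]
  have hdvd : ∀ x ∈ primePowers g n, x.1 ∣ Ideal.span {(q : R)} := by
    rintro ⟨P, k⟩ hx
    obtain ⟨hP, hnP, -⟩ := mem_primePowers.1 hx
    simp only at hnP
    obtain ⟨q', f', hf', hq', hN', hd⟩ := exists_prime_mem hP
    have h1 : q' ∣ q ^ (f * (k₀ + 1)) := by
      rw [← hn, ← hnP, hN', ← pow_mul]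
      exact dvd_pow_self _ (by positivity)
    rwa [(Nat.prime_dvd_prime_iff_eq hq' hq).1 (hq'.dvd_of_dvd_pow h1)] at hd
  have hinj : Set.InjOn Prod.fst (primePowers g n : Set (Ideal R × ℕ)) := by
    rintro ⟨P, k⟩ hx ⟨P', k'⟩ hx' (rfl : P = P')
    rw [Finset.mem_coe, mem_primePowers] at hx hx'
    have h1 := Nat.pow_right_injective (one_lt_absNorm hx.1) (hx.2.1.trans hx'.2.1.symm)
    simp only [add_left_inj] at h1
    rw [h1]
  rw [hΛ, ← Finset.sum_image (s := primePowers g n) (g := Prod.fst)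
    (f := fun P : Ideal R => Real.log (Ideal.absNorm P)) hinj,
    ← Real.log_prod, ← Real.log_pow]
  · have h1 : ∏ P ∈ (primePowers g n).image Prod.fst, P ∣ Ideal.span {(q : R)} := by
      refine Finset.prod_primes_dvd _ ?_ ?_
      · intro P hP
        obtain ⟨x, hx, rfl⟩ := Finset.mem_image.1 hP
        exact (mem_primePowers.1 hx).1
      · intro P hP
        obtain ⟨x, hx, rfl⟩ := Finset.mem_image.1 hP
        exact hdvd x hx
    have h2 := Ideal.absNorm_dvd_absNorm_of_le (Ideal.dvd_iff_le.1 h1)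
    rw [Ideal.absNorm_span_natCast, map_prod] at h2
    have h3 := Nat.le_of_dvd (pow_pos hq.pos _) h2
    have h4 : 0 < ∏ P ∈ (primePowers g n).image Prod.fst, Ideal.absNorm P :=
      Nat.pos_of_dvd_of_pos h2 (pow_pos hq.pos _)
    exact Real.log_le_log (by exact_mod_cast h4) (by exact_mod_cast h3)
  · intro P hP
    obtain ⟨x, hx, rfl⟩ := Finset.mem_image.1 hP
    exact_mod_cast absNorm_ne_zero (mem_primePowers.1 hx).1.ne_zero

theorem exists_prime_ideal_of_not_summable (g : Additive (ClassGroup R))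
    (h : ¬ Summable fun n : ℕ => ‖mangoldt g n‖ / n) (N : ℕ) :
    ∃ P : Ideal R, (Ideal.absNorm P).Prime ∧ N < Ideal.absNorm P ∧ cls P = g := by
  by_contra! hc
  apply h
  have hzero : ∀ q : ℕ, q.Prime → N < q → mangoldt g q = 0 := by
    intro q hq hN
    rw [mangoldt_apply, Finset.sum_eq_zero, Complex.ofReal_zero]
    rintro ⟨P, k⟩ hx
    obtain ⟨hP, hn, hcl⟩ := mem_primePowers.1 hx
    simp only at hn hcl
    have hk : k = 0 := by
      have := Nat.Prime.eq_one_of_pow (hn.symm ▸ hq)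
      omega
    subst hk
    rw [zero_add, pow_one] at hn
    rw [zero_add, one_nsmul] at hcl
    exact absurd hcl (hc P (hn ▸ hq) (hn ▸ hN))
  have hs := (ArithmeticFunction.vonMangoldt.summable_residueClass_non_primes_div
    (q := 1) 0).mul_left (Module.finrank ℤ R : ℝ)
  refine Summable.of_norm_bounded_eventually_nat hs ?_
  filter_upwards [Filter.eventually_gt_atTop N] with n hn
  rw [norm_div, norm_norm, Real.norm_natCast, ← mul_div_assoc]
  gcongr
  split_ifs with hq
  · rw [hzero n hq hn, norm_zero, mul_zero]
  · have : ArithmeticFunction.vonMangoldt.residueClass (0 : ZMod 1) n =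
        ArithmeticFunction.vonMangoldt n := by
      rw [ArithmeticFunction.vonMangoldt.residueClass, Set.indicator_of_mem]
      exact Subsingleton.elim _ _
    rw [this, mangoldt_apply, Complex.norm_real, Real.norm_of_nonneg]
    · exact sum_log_le g n
    · exact Finset.sum_nonneg fun x _ => Real.log_natCast_nonneg _

end IdealCount

namespace QuadOrder

variable (u v : ℤ) [NegFundamental u v]

open IdealCount

/-- The partial zeta functions of the ideal classes of a maximal imaginary quadratic order. -/
noncomputable def zetaData : PartialZetaData (Additive (ClassGroup (IntRing u v))) where
  a := count
  lam := mangoldt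
  E g := (exists_hasSum_count u v g).choose
  κ := latticeResidue u v / Nat.card (IntRing u v)ˣ
  a_nonneg := count_nonneg
  lam_nonneg := mangoldt_nonneg
  a_zero_one := count_zero_one
  a_one _ := count_one
  mul_log := count_mul_log
  summable g s hs := ((exists_hasSum_count u v g).choose_spec.2.2 s hs).summable
  differentiable_E g := (exists_hasSum_count u v g).choose_spec.1
  κ_ne_zero := by
    have := finite_units u v
    exact div_ne_zero (latticeResidue_ne_zero u v) (by exact_mod_cast Nat.card_pos.ne')
  LSeries_eq g s hs := ((exists_hasSum_count u v g).choose_spec.2.2 s hs).tsum_eq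
  E_neg_one g := (exists_hasSum_count u v g).choose_spec.2.1

theorem exists_prime_ideal (g : Additive (ClassGroup (IntRing u v))) (N : ℕ) :
    ∃ P : Ideal (IntRing u v), (Ideal.absNorm P).Prime ∧ N < Ideal.absNorm P ∧ cls P = g :=
  exists_prime_ideal_of_not_summable g ((zetaData u v).not_summable g) N

end QuadOrder

end

section

namespace QuadOrder

/-- The ideal `ℤ a + ℤ ω` attached to the form `[a, b, c]`, where `ω² + b ω + a c = 0`. -/
def formIdeal (a b c : ℤ) : Ideal (IntRing (-(a * c)) (-b)) where
  carrier := {z | a ∣ z.re}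
  add_mem' := fun {z w} hz hw => by
    simpa using dvd_add hz hw
  zero_mem' := by simp
  smul_mem' := fun z w hw => by
    simp only [Set.mem_setOf_eq, smul_eq_mul, QuadraticAlgebra.re_mul] at hw ⊢
    exact dvd_add (hw.mul_left _) ⟨-c * z.im * w.im, by ring⟩

theorem mem_formIdeal {a b c : ℤ} {z : IntRing (-(a * c)) (-b)} :
    z ∈ formIdeal a b c ↔ a ∣ z.re := Iff.rfl

theorem absNorm_formIdeal {a b c : ℤ} [NegFundamental (-(a * c)) (-b)] :
    Ideal.absNorm (formIdeal a b c) = a.natAbs := by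
  let f : IntRing (-(a * c)) (-b) →+ ZMod a.natAbs :=
    { toFun z := (z.re : ZMod a.natAbs)
      map_zero' := by simp
      map_add' z w := by simp }
  have hker : (formIdeal a b c).toAddSubgroup = f.ker := by
    ext z
    change a ∣ z.re ↔ (z.re : ZMod a.natAbs) = 0
    rw [ZMod.intCast_zmod_eq_zero_iff_dvd, Int.natAbs_dvd]
  have hsurj : Function.Surjective f := fun w => by
    obtain ⟨m, rfl⟩ := ZMod.intCast_surjective w
    exact ⟨⟨m, 0⟩, rfl⟩
  rw [Ideal.absNorm_eq_index, hker, AddSubgroup.index_ker,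
    AddMonoidHom.range_eq_top_of_surjective f hsurj]
  change Nat.card (⊤ : AddSubgroup (ZMod a.natAbs)) = _
  rw [AddSubgroup.card_top, Nat.card_zmod]

open IdealCount in
/-- A positive definite form of negative fundamental discriminant represents arbitrarily large
primes. -/
theorem exists_prime_represented (a b c : ℤ) (ha : 0 < a) [NegFundamental (-(a * c)) (-b)]
    (N : ℕ) : ∃ q : ℕ, q.Prime ∧ N < q ∧ ∃ x y : ℤ, a * x ^ 2 + b * x * y + c * y ^ 2 = q := by
  have hI : formIdeal a b c ≠ 0 := by
    intro h
    have := absNorm_formIdeal (a := a) (b := b) (c := c)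
    rw [h, map_zero] at this
    omega
  obtain ⟨P, hP, hN, hcls⟩ := exists_prime_ideal (-(a * c)) (-b) (-cls (formIdeal a b c)) N
  have hP0 : P ≠ 0 := by rintro rfl; exact Nat.not_prime_zero (by simpa using hP)
  obtain ⟨z, hz, hspan⟩ := (cls_eq_zero_iff (mul_ne_zero hP0 hI)).1 (by
    rw [cls_mul hP0 hI, hcls, neg_add_cancel])
  have hmem : z ∈ formIdeal a b c := (Ideal.span_singleton_le_iff_mem _).1
    (hspan.symm.trans_le Ideal.mul_le_right)
  obtain ⟨x, hx⟩ := mem_formIdeal.1 hmem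
  have hnorm := absNorm_span (-(a * c)) (-b) (z := z)
  rw [← hspan, map_mul, absNorm_formIdeal, Nat.cast_mul, Int.natCast_natAbs, abs_of_pos ha,
    QuadraticAlgebra.norm_def, hx] at hnorm
  refine ⟨_, hP, hN, x, -z.im, mul_left_cancel₀ ha.ne' ?_⟩
  linarith

end QuadOrder

end

theorem IsFundamentalDiscriminant.cases {E : ℤ} (h : IsFundamentalDiscriminant E) :
    (E % 4 = 1 ∧ Squarefree E) ∨
      ∃ m, E = 4 * m ∧ Squarefree m ∧ (m % 4 = 2 ∨ m % 4 = 3) := by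
  rcases h with h | ⟨h1, h2, h3⟩
  · exact Or.inl h
  · exact Or.inr ⟨E / 4, by omega, h2, h3⟩

theorem Int.squarefree_mul_of_isCoprime {m n : ℤ} (h : IsCoprime m n) (hm : Squarefree m)
    (hn : Squarefree n) : Squarefree (m * n) :=
  (squarefree_mul_iff).2 ⟨h.isRelPrime, hm, hn⟩

theorem isUnit_of_sq_mul_of_even {m E f e : ℤ} (hm : Squarefree (m * E))
    (hm4 : m % 4 = 2 ∨ m % 4 = 3) (hE : E % 4 = 1) (h : 4 * m * E = f ^ 2 * e)
    (he : e % 4 = 0 ∨ e % 4 = 1) : IsUnit f := by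
  have hmE : (m * E) % 4 = 2 ∨ (m * E) % 4 = 3 := by
    rw [Int.mul_emod, hE]
    rcases hm4 with h | h <;> rw [h] <;> norm_num
  rcases Int.even_or_odd' f with ⟨k, rfl | rfl⟩
  · exfalso
    have h1 : m * E = k ^ 2 * e := by linarith
    rw [h1, Int.mul_emod, pow_two, Int.mul_emod k k] at hmE
    have hk : k % 4 = 0 ∨ k % 4 = 1 ∨ k % 4 = 2 ∨ k % 4 = 3 := by omega
    rcases hk with hk | hk | hk | hk <;> rcases he with he | he <;> rw [hk, he] at hmE <;>
      norm_num at hmE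
  · have h4 : (4 : ℤ) ∣ e := by
      have h2 : IsCoprime (4 : ℤ) ((2 * k + 1) ^ 2) := by
        refine IsCoprime.pow_right ?_
        rw [show (4 : ℤ) = 2 ^ 2 by norm_num]
        exact IsCoprime.pow_left ⟨-k, 1, by ring⟩
      exact h2.dvd_of_dvd_mul_left ⟨m * E, by linarith⟩
    obtain ⟨e', rfl⟩ := h4
    refine hm _ ⟨e', ?_⟩
    linarith

theorem isUnit_of_fundamental_mul {D E f e : ℤ} (hD : IsFundamentalDiscriminant D)
    (hE : IsFundamentalDiscriminant E) (hDE : IsCoprime D E) (h : D * E = f ^ 2 * e)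
    (he : e % 4 = 0 ∨ e % 4 = 1) : IsUnit f := by
  rcases hD.cases with ⟨hD4, hDs⟩ | ⟨m, rfl, hms, hm4⟩ <;>
    rcases hE.cases with ⟨hE4, hEs⟩ | ⟨n, rfl, hns, hn4⟩
  · exact Int.squarefree_mul_of_isCoprime hDE hDs hEs f ⟨e, by rw [h]; ring⟩
  · have hc : IsCoprime n D := hDE.symm.of_mul_left_right
    exact isUnit_of_sq_mul_of_even (Int.squarefree_mul_of_isCoprime hc hns hDs) hn4 hD4
      (by linarith) he
  · have hc : IsCoprime m E := hDE.of_mul_left_right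
    exact isUnit_of_sq_mul_of_even (Int.squarefree_mul_of_isCoprime hc hms hEs) hm4 hE4
      (by linarith) he
  · have h2 : IsUnit (4 : ℤ) := hDE.isUnit_of_dvd' ⟨m, rfl⟩ ⟨n, rfl⟩
    rw [Int.isUnit_iff] at h2
    omega

/-- The integer `Δ` is a negative fundamental discriminant, in the sense that it is not a proper
square multiple of another discriminant. -/
def IsNegFundamental (Δ : ℤ) : Prop :=
  Δ < 0 ∧ ∀ f e : ℤ, Δ = f ^ 2 * e → (e % 4 = 0 ∨ e % 4 = 1) → IsUnit f

theorem isNegFundamental_mul {D d : ℤ} (hD1 : 1 < D) (hd : 0 < d)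
    (hD : IsFundamentalDiscriminant D) (hdf : IsFundamentalDiscriminant (-d))
    (hcop : IsCoprime D d) : IsNegFundamental (-(d * D)) :=
  ⟨by nlinarith, fun f e h he => isUnit_of_fundamental_mul hD hdf hcop.neg_right
    (by rw [← h]; ring) he⟩

theorem IsNegFundamental.negFundamental {Δ : ℤ} (h : IsNegFundamental Δ) {Q : BQF}
    (hQ : Q.disc = Δ) : NegFundamental (-(Q.a * Q.c)) (-Q.b) where
  neg := by
    have := h.1
    rw [← hQ, BQF.disc] at this
    linarith
  isUnit_of_sq_mul f e hf := h.2 f e (by rw [← hQ, BQF.disc, ← hf]; ring)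

theorem Int.sq_sub_four_mul_emod (b n : ℤ) :
    (b ^ 2 - 4 * n) % 4 = 0 ∨ (b ^ 2 - 4 * n) % 4 = 1 := by
  rcases Int.even_or_odd' b with ⟨k, rfl | rfl⟩ <;> ring_nf <;> omega

theorem IsNegFundamental.isUnit_of_dvd {Δ : ℤ} (h : IsNegFundamental Δ) {Q : BQF}
    (hQ : Q.disc = Δ) {f : ℤ} (ha : f ∣ Q.a) (hb : f ∣ Q.b) (hc : f ∣ Q.c) : IsUnit f := by
  obtain ⟨a, ha⟩ := ha
  obtain ⟨b, hb⟩ := hb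
  obtain ⟨c, hc⟩ := hc
  refine h.2 f (b ^ 2 - 4 * (a * c)) ?_ (Int.sq_sub_four_mul_emod _ _)
  rw [← hQ, BQF.disc, ha, hb, hc]
  ring

namespace BQF

theorem act_mul (Q : BQF) (g h : Matrix.SpecialLinearGroup (Fin 2) ℤ) :
    Q.act (g * h) = (Q.act g).act h := by
  simp only [act, Matrix.SpecialLinearGroup.coe_mul, Matrix.mul_apply, Fin.sum_univ_two, mk.injEq]
  refine ⟨?_, ?_, ?_⟩ <;> ring

theorem act_one (Q : BQF) : Q.act 1 = Q := by
  simp [act]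

theorem act_inv_eq {Q Q' : BQF} {g : Matrix.SpecialLinearGroup (Fin 2) ℤ} (h : Q.act g = Q') :
    Q'.act g⁻¹ = Q := by
  rw [← h, ← act_mul, mul_inv_cancel, act_one]

theorem det_eq (g : Matrix.SpecialLinearGroup (Fin 2) ℤ) :
    g.1 0 0 * g.1 1 1 - g.1 0 1 * g.1 1 0 = 1 := by
  rw [← Matrix.det_fin_two]; exact g.2

theorem disc_act (Q : BQF) (g : Matrix.SpecialLinearGroup (Fin 2) ℤ) :
    (Q.act g).disc = Q.disc := by
  have h := det_eq g
  have h2 : (Q.act g).disc =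
      Q.disc * (g.1 0 0 * g.1 1 1 - g.1 0 1 * g.1 1 0) ^ 2 := by
    simp only [act, disc]; ring
  rw [h2, h]; ring

theorem IsPosDef.act {Q : BQF} (h : Q.IsPosDef) (g : Matrix.SpecialLinearGroup (Fin 2) ℤ) :
    (Q.act g).IsPosDef := by
  refine ⟨?_, by rw [disc_act]; exact h.2⟩
  obtain ⟨ha, hd⟩ := h
  have hdet := det_eq g
  simp only [BQF.act]
  rw [disc] at hd
  by_contra! hc
  have h4 : 4 * Q.a * (Q.a * g.1 0 0 ^ 2 + Q.b * g.1 0 0 * g.1 1 0 + Q.c * g.1 1 0 ^ 2) =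
    (2 * Q.a * g.1 0 0 + Q.b * g.1 1 0) ^ 2 - (Q.b ^ 2 - 4 * Q.a * Q.c) * g.1 1 0 ^ 2 := by ring
  have h5 : (2 * Q.a * g.1 0 0 + Q.b * g.1 1 0) ^ 2 -
      (Q.b ^ 2 - 4 * Q.a * Q.c) * g.1 1 0 ^ 2 ≤ 0 := by
    rw [← h4]; nlinarith
  have h6 : g.1 1 0 = 0 := by
    by_contra h0
    have := sq_pos_of_ne_zero h0
    nlinarith [sq_nonneg (2 * Q.a * g.1 0 0 + Q.b * g.1 1 0)]
  have h7 : g.1 0 0 = 0 := by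
    rw [h6] at h5
    by_contra h0
    have h8 : 2 * Q.a * g.1 0 0 ≠ 0 := mul_ne_zero (by linarith) h0
    have := sq_pos_of_ne_zero h8
    nlinarith
  rw [h6, h7] at hdet
  omega

theorem mem.act {d : ℤ} {Q : BQF} (h : Q.mem d) (g : Matrix.SpecialLinearGroup (Fin 2) ℤ) :
    (Q.act g).mem d := ⟨h.1.act g, by rw [disc_act]; exact h.2⟩

/-- Completion of a primitive kernel vector modulo `p` to an element of `SL₂(ℤ)`. -/
theorem exists_act_of_kernel {Q : BQF} {p r s x y : ℤ} (hp : Prime p) (hb : Q.b = r + s)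
    (hxy : ¬ (p ∣ x ∧ p ∣ y)) (h1 : p ∣ Q.a * x + s * y) (h2 : p ∣ r * x + Q.c * y) :
    ∃ g : Matrix.SpecialLinearGroup (Fin 2) ℤ, p ∣ (Q.act g).a ∧
      (Q.act g).b ≡ s - r [ZMOD (2 * p)] := by
  have hxy0 : 0 < Int.gcd x y := by
    rw [Int.gcd_pos_iff]
    by_contra! hc
    exact hxy (by rw [hc.1, hc.2]; simp)
  obtain ⟨x', y', hg, hx, hy⟩ := Int.exists_gcd_one hxy0
  have hpg : ¬ p ∣ (Int.gcd x y : ℤ) := fun h =>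
    hxy ⟨h.trans (Int.gcd_dvd_left ..), h.trans (Int.gcd_dvd_right ..)⟩
  obtain ⟨G, hG⟩ : ∃ G : ℤ, G = Int.gcd x y := ⟨_, rfl⟩
  rw [← hG] at hx hy hpg
  have k1 : p ∣ Q.a * x' + s * y' := by
    refine (hp.dvd_or_dvd (?_ : p ∣ G * _)).resolve_left hpg
    rwa [show G * (Q.a * x' + s * y') = Q.a * x + s * y by rw [hx, hy]; ring]
  have k2 : p ∣ r * x' + Q.c * y' := by
    refine (hp.dvd_or_dvd (?_ : p ∣ G * _)).resolve_left hpg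
    rwa [show G * (r * x' + Q.c * y') = r * x + Q.c * y by rw [hx, hy]; ring]
  obtain ⟨δ, η, hdet⟩ : IsCoprime x' y' := Int.isCoprime_iff_gcd_eq_one.2 hg
  refine ⟨⟨!![x', -η; y', δ], by rw [Matrix.det_fin_two_of]; linarith⟩, ?_, ?_⟩
  · simp only [act, Matrix.of_apply, Matrix.cons_val', Matrix.cons_val_zero, Matrix.cons_val_one,
      Matrix.cons_val_fin_one]
    have e : Q.a * x' ^ 2 + Q.b * x' * y' + Q.c * y' ^ 2 =
        x' * (Q.a * x' + s * y') + y' * (r * x' + Q.c * y') := by rw [hb]; ring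
    rw [e]
    exact dvd_add (k1.mul_left x') (k2.mul_left y')
  · simp only [act, Matrix.of_apply, Matrix.cons_val', Matrix.cons_val_zero, Matrix.cons_val_one,
      Matrix.cons_val_fin_one]
    refine (Int.modEq_iff_dvd.2 ?_).symm
    have e : 2 * Q.a * x' * -η + Q.b * (x' * δ + -η * y') + 2 * Q.c * y' * δ - (s - r) =
        2 * (-η * (Q.a * x' + s * y') + δ * (r * x' + Q.c * y')) := by
      rw [hb]
      linear_combination (s - r) * hdet
    rw [e]
    exact mul_dvd_mul_left 2 (dvd_add (k1.mul_left (-η)) (k2.mul_left δ))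

theorem exists_half {p β Δ : ℤ} (hβ : β ^ 2 ≡ Δ [ZMOD (4 * p)]) {Q : BQF} (hQ : Q.disc = Δ) :
    ∃ r s : ℤ, Q.b = r + s ∧ β = s - r ∧ p ∣ Q.a * Q.c - r * s := by
  obtain ⟨w, hw⟩ := (Int.modEq_iff_dvd.1 hβ)
  rw [← hQ, disc] at hw
  have hpar : (Q.b - β) % 2 = 0 := by
    have h1 : (Q.b - β) * (Q.b + β) = 2 * (2 * (p * w + Q.a * Q.c)) := by linarith
    have h3 : (2 : ℤ) ∣ (Q.b - β) * (Q.b + β) := ⟨_, h1⟩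
    rcases Int.prime_two.dvd_or_dvd h3 with h | h <;> omega
  refine ⟨(Q.b - β) / 2, Q.b - (Q.b - β) / 2, by ring, by omega, ?_⟩
  set r := (Q.b - β) / 2 with hr
  have hb : β = Q.b - 2 * r := by omega
  refine ⟨-w, ?_⟩
  rw [hb] at hw
  linarith

theorem exists_act_memN {p : ℕ} (hp : p.Prime) {d β : ℤ} (hd : IsNegFundamental (-d))
    (hβ : β ^ 2 ≡ -d [ZMOD (4 * p)]) {Q : BQF} (hQ : Q.mem d) :
    ∃ g : Matrix.SpecialLinearGroup (Fin 2) ℤ, (Q.act g).memN d p β := by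
  have hp' : Prime (p : ℤ) := Nat.prime_iff_prime_int.1 hp
  obtain ⟨r, s, hb, rfl, hdvd⟩ := exists_half hβ hQ.2
  suffices h : ∃ x y : ℤ, ¬ ((p : ℤ) ∣ x ∧ (p : ℤ) ∣ y) ∧ (p : ℤ) ∣ Q.a * x + s * y ∧
      (p : ℤ) ∣ r * x + Q.c * y by
    obtain ⟨x, y, h0, h1, h2⟩ := h
    obtain ⟨g, hg1, hg2⟩ := exists_act_of_kernel hp' hb h0 h1 h2
    exact ⟨g, hQ.act g, hg1, hg2⟩
  by_cases h : (p : ℤ) ∣ Q.a ∧ (p : ℤ) ∣ s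
  · refine ⟨Q.c, -r, ?_, dvd_add (h.1.mul_right _) (h.2.mul_right _), ⟨0, by ring⟩⟩
    rintro ⟨hc, hr⟩
    rw [dvd_neg] at hr
    exact hp'.not_isUnit (hd.isUnit_of_dvd hQ.2 h.1 (hb ▸ dvd_add hr h.2) hc)
  · refine ⟨-s, Q.a, fun hc => h ⟨hc.2, (dvd_neg.1 hc.1)⟩, ⟨0, by ring⟩, ?_⟩
    convert hdvd using 1
    ring

theorem mem_Gamma0_of_act_memN {p : ℕ} (hp : p.Prime) {d β : ℤ} (hd : IsNegFundamental (-d))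
    {Q : BQF} {g : Matrix.SpecialLinearGroup (Fin 2) ℤ}
    (hQ : Q.memN d p β) (hQ' : (Q.act g).memN d p β) : g ∈ CongruenceSubgroup.Gamma0 p := by
  have hp' : Prime (p : ℤ) := Nat.prime_iff_prime_int.1 hp
  obtain ⟨hQm, hpa, hbβ⟩ := hQ
  obtain ⟨-, hpa', hbβ'⟩ := hQ'
  have hdet := det_eq g
  obtain ⟨r, hr⟩ := Int.modEq_iff_dvd.1 hbβ.symm
  obtain ⟨w, hw⟩ := Int.modEq_iff_dvd.1 hbβ'.symm
  obtain ⟨a, ha⟩ := hpa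
  obtain ⟨a', ha'⟩ := hpa'
  simp only [act] at ha' hw
  set α := g.1 0 0
  set η := g.1 0 1
  set γ := g.1 1 0
  set δ := g.1 1 1
  have hs : Q.b = p * r + (β + p * r) := by linarith
  set s := β + p * r with hsd
  have hX : (p : ℤ) ∣ s * γ := by
    have e : Q.a * α + s * γ = p * (δ * a' - γ * w) := by
      have h1 : (Q.a * α + s * γ) * α + (p * r * α + Q.c * γ) * γ = p * a' := by
        rw [← ha', hs]; ring
      have h2 : (Q.a * α + s * γ) * η + (p * r * α + Q.c * γ) * δ = p * w := by
        have h3 : 2 * ((Q.a * α + s * γ) * η + (p * r * α + Q.c * γ) * δ) = 2 * (p * w) := by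
          rw [← mul_assoc, ← hw, hs, hsd]
          linear_combination (-β) * hdet
        linarith
      linear_combination δ * h1 - γ * h2 - (Q.a * α + s * γ) * hdet
    refine ⟨δ * a' - γ * w - a * α, ?_⟩
    rw [ha] at e
    linarith
  have hY : (p : ℤ) ∣ Q.c * γ := by
    have e : p * r * α + Q.c * γ = p * (α * w - η * a') := by
      have h1 : (Q.a * α + s * γ) * α + (p * r * α + Q.c * γ) * γ = p * a' := by
        rw [← ha', hs]; ring
      have h2 : (Q.a * α + s * γ) * η + (p * r * α + Q.c * γ) * δ = p * w := by
        have h3 : 2 * ((Q.a * α + s * γ) * η + (p * r * α + Q.c * γ) * δ) = 2 * (p * w) := by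
          rw [← mul_assoc, ← hw, hs, hsd]
          linear_combination (-β) * hdet
        linarith
      linear_combination α * h2 - η * h1 - (p * r * α + Q.c * γ) * hdet
    exact ⟨α * w - η * a' - r * α, by linarith⟩
  rw [CongruenceSubgroup.Gamma0_mem, ZMod.intCast_zmod_eq_zero_iff_dvd]
  by_contra hγ
  refine hp'.not_isUnit (hd.isUnit_of_dvd hQm.2 ⟨a, ha⟩ ?_ ((hp'.dvd_or_dvd hY).resolve_right hγ))
  rw [hs]
  exact dvd_add ⟨r, rfl⟩ ((hp'.dvd_or_dvd hX).resolve_right hγ)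

theorem sum_eq_sum_of_invariant {p : ℕ} (hp : p.Prime) {d β : ℤ} (hd : IsNegFundamental (-d))
    (hβ : β ^ 2 ≡ -d [ZMOD (4 * p)]) {Rp R1 : Finset BQF}
    (hRp : ∀ Q ∈ Rp, Q.memN d p β)
    (hRpineq : ∀ Q ∈ Rp, ∀ Q' ∈ Rp, Q ≠ Q' → ¬ equiv (CongruenceSubgroup.Gamma0 p) Q Q')
    (hRpcover : ∀ Q : BQF, Q.memN d p β → ∃ Q' ∈ Rp, equiv (CongruenceSubgroup.Gamma0 p) Q Q')
    (hR1 : ∀ Q ∈ R1, Q.mem d)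
    (hR1ineq : ∀ Q ∈ R1, ∀ Q' ∈ R1, Q ≠ Q' → ¬ equiv ⊤ Q Q')
    (hR1cover : ∀ Q : BQF, Q.mem d → ∃ Q' ∈ R1, equiv ⊤ Q Q') (f : BQF → ℂ)
    (hf : ∀ Q : BQF, Q.mem d → ∀ g, f (Q.act g) = f Q) :
    ∑ Q ∈ Rp, f Q = ∑ Q ∈ R1, f Q := by
  have hcov : ∀ Q : BQF, ∃ Q', Q.mem d → Q' ∈ R1 ∧ ∃ g, Q.act g = Q' := fun Q => by
    by_cases h : Q.mem d
    · obtain ⟨Q', h1, g, -, hg⟩ := hR1cover Q h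
      exact ⟨Q', fun _ => ⟨h1, g, hg⟩⟩
    · exact ⟨Q, fun h' => absurd h' h⟩
  choose F hF using hcov
  refine Finset.sum_nbij F ?_ ?_ ?_ ?_
  · exact fun Q hQ => (hF Q (hRp Q hQ).1).1
  · intro Q hQ Q' hQ' he
    obtain ⟨-, g, hg⟩ := hF Q (hRp Q hQ).1
    obtain ⟨-, g', hg'⟩ := hF Q' (hRp Q' hQ').1
    have h1 : Q.act (g * g'⁻¹) = Q' := by
      rw [act_mul, hg, he]
      exact act_inv_eq hg'
    by_contra hne
    exact hRpineq Q hQ Q' hQ' hne ⟨g * g'⁻¹, mem_Gamma0_of_act_memN hp hd (hRp Q hQ)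
      (h1 ▸ hRp Q' hQ'), h1⟩
  · intro Q hQ
    obtain ⟨g, hg⟩ := exists_act_memN hp hd hβ (hR1 Q hQ)
    obtain ⟨Q', hQ', g', -, hg'⟩ := hRpcover _ hg
    refine ⟨Q', hQ', ?_⟩
    obtain ⟨hm, h, hh⟩ := hF Q' (hRp Q' hQ').1
    by_contra hne
    refine hR1ineq Q hQ _ hm (Ne.symm hne) ⟨g * g' * h, trivial, ?_⟩
    rw [act_mul, act_mul, hg', hh]
  · intro Q hQ
    obtain ⟨-, g, hg⟩ := hF Q (hRp Q hQ).1
    rw [← hg, hf Q (hRp Q hQ).1]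

end BQF

theorem moebiusZ_mem_upperH (g : Matrix.SpecialLinearGroup (Fin 2) ℤ) {z : ℂ} (hz : z ∈ UpperH) :
    moebiusZ g z ∈ UpperH := by
  have hdet := BQF.det_eq g
  set w : UpperHalfPlane := ⟨z, hz⟩
  have h := (g • w).im_pos
  have e : ((g • w : UpperHalfPlane) : ℂ) = moebiusZ g z := by
    rw [UpperHalfPlane.specialLinearGroup_apply]
    simp [moebiusZ, w]
  change 0 < (moebiusZ g z).im
  rw [← e]
  exact h

namespace BQF

theorem IsPosDef.root_mem {Q : BQF} (h : Q.IsPosDef) : Q.root ∈ UpperH := by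
  obtain ⟨ha, hd⟩ := h
  have e : Q.root = (⟨-(Q.b : ℝ) / (2 * Q.a), √(-(Q.disc : ℝ)) / (2 * Q.a)⟩ : ℂ) := by
    have ha' : (Q.a : ℂ) ≠ 0 := by exact_mod_cast ha.ne'
    have ha'' : (Q.a : ℝ) ≠ 0 := by exact_mod_cast ha.ne'
    rw [root, Complex.mk_eq_add_mul_I]
    push_cast
    field_simp
  rw [e]
  have h1 : (0 : ℝ) < Q.a := by exact_mod_cast ha
  have h2 : (0 : ℝ) < -(Q.disc : ℝ) := by
    have : (Q.disc : ℝ) < 0 := by exact_mod_cast hd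
    linarith
  change 0 < √(-(Q.disc : ℝ)) / (2 * Q.a)
  positivity

theorem IsPosDef.root_eq_zero {Q : BQF} (h : Q.IsPosDef) :
    Q.a * Q.root ^ 2 + Q.b * Q.root + Q.c = 0 := by
  have ha' : (Q.a : ℂ) ≠ 0 := by exact_mod_cast h.1.ne'
  have h2 : (0 : ℝ) ≤ -(Q.disc : ℝ) := by
    have : (Q.disc : ℝ) < 0 := by exact_mod_cast h.2
    linarith
  have h3 : ((√(-(Q.disc : ℝ)) : ℝ) : ℂ) ^ 2 = -(Q.b ^ 2 - 4 * Q.a * Q.c) := by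
    rw [← Complex.ofReal_pow, Real.sq_sqrt h2, disc]
    push_cast
    ring
  rw [root]
  field_simp
  linear_combination Complex.I ^ 2 * h3 - (Q.b ^ 2 - 4 * Q.a * Q.c : ℂ) * Complex.I_sq

theorem IsPosDef.eq_root {Q : BQF} (h : Q.IsPosDef) {z : ℂ} (hz : z ∈ UpperH)
    (h0 : Q.a * z ^ 2 + Q.b * z + Q.c = 0) : z = Q.root := by
  have hr := h.root_eq_zero
  have ha' : (Q.a : ℂ) ≠ 0 := by exact_mod_cast h.1.ne'
  have e : (z - Q.root) * (Q.a * (z + Q.root) + Q.b) = 0 := by linear_combination h0 - hr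
  rcases mul_eq_zero.1 e with e | e
  · linear_combination e
  · exfalso
    have him := congrArg Complex.im e
    have h1 : 0 < z.im := hz
    have h2 : 0 < Q.root.im := h.root_mem
    have h3 : (0 : ℝ) < Q.a := by exact_mod_cast h.1
    simp only [Complex.add_im, Complex.mul_im, Complex.intCast_re, Complex.intCast_im, zero_mul,
      add_zero, Complex.zero_im] at him
    nlinarith

theorem moebiusZ_root_act {Q : BQF} (h : Q.IsPosDef) (g : Matrix.SpecialLinearGroup (Fin 2) ℤ) :
    moebiusZ g (Q.act g).root = Q.root := by
  have hw := (h.act g).root_mem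
  have h0 := (h.act g).root_eq_zero
  set w := (Q.act g).root
  refine h.eq_root (moebiusZ_mem_upperH g hw) ?_
  have hne : (g.1 1 0 : ℂ) * w + (g.1 1 1 : ℂ) ≠ 0 :=
    UpperHalfPlane.denom_ne_zero (Matrix.SpecialLinearGroup.toGL (g.map (Int.castRingHom ℝ))) ⟨w, hw⟩
  have key : ∀ A B C n m : ℂ, m ≠ 0 → A * n ^ 2 + B * n * m + C * m ^ 2 = 0 →
      A * (n / m) ^ 2 + B * (n / m) + C = 0 := fun A B C n m hm h => by
    field_simp
    linear_combination h
  refine key _ _ _ _ _ hne ?_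
  rw [← h0]
  simp only [act]
  push_cast
  ring

/-- The Fricke involution of level `p` on forms whose leading coefficient is divisible by `p`. -/
def fricke (p : ℕ) (Q : BQF) : BQF := ⟨p * Q.c, -Q.b, Q.a / p⟩

theorem memN.fricke {p : ℕ} (hp : 0 < p) {d β : ℤ} {Q : BQF} (h : Q.memN d p β) :
    (Q.fricke p).memN d p (-β) := by
  obtain ⟨⟨⟨ha, hneg⟩, hd⟩, hdvd, hb⟩ := h
  have hp' : (0 : ℤ) < p := by exact_mod_cast hp
  have hd' : (Q.fricke p).disc = Q.disc := by
    obtain ⟨a, ha⟩ := hdvd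
    simp only [BQF.fricke, disc, ha]
    rw [Int.mul_ediv_cancel_left _ hp'.ne']
    ring
  refine ⟨⟨⟨?_, by rwa [hd']⟩, by rwa [hd']⟩, ⟨Q.c, rfl⟩, ?_⟩
  · refine mul_pos hp' ?_
    rw [disc] at hneg
    nlinarith [sq_nonneg Q.b]
  · exact hb.neg

theorem fricke_fricke {p : ℕ} (hp : 0 < p) {Q : BQF} (h : (p : ℤ) ∣ Q.a) :
    (Q.fricke p).fricke p = Q := by
  have hp' : (0 : ℤ) < p := by exact_mod_cast hp
  obtain ⟨a, b, c⟩ := Q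
  simp only [fricke, neg_neg, mk.injEq, true_and]
  exact ⟨Int.mul_ediv_cancel' h, Int.mul_ediv_cancel_left _ hp'.ne'⟩

theorem exists_fricke_act {p : ℕ} (hp : 0 < p) {Q : BQF} (h : (p : ℤ) ∣ Q.a)
    {g : Matrix.SpecialLinearGroup (Fin 2) ℤ} (hg : g ∈ CongruenceSubgroup.Gamma0 p) :
    ∃ g' ∈ CongruenceSubgroup.Gamma0 p, (Q.act g).fricke p = (Q.fricke p).act g' := by
  have hp' : (0 : ℤ) < p := by exact_mod_cast hp
  have hdet := det_eq g
  rw [CongruenceSubgroup.Gamma0_mem, ZMod.intCast_zmod_eq_zero_iff_dvd] at hg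
  obtain ⟨γ, hγ⟩ := hg
  obtain ⟨a, ha⟩ := h
  have hdet' : (!![g.1 1 1, -γ; -(p * g.1 0 1), g.1 0 0] : Matrix _ _ ℤ).det = 1 := by
    rw [Matrix.det_fin_two_of]
    rw [hγ] at hdet
    linarith
  let g' : Matrix.SpecialLinearGroup (Fin 2) ℤ := ⟨_, hdet'⟩
  refine ⟨g', ?_, ?_⟩
  · rw [CongruenceSubgroup.Gamma0_mem, ZMod.intCast_zmod_eq_zero_iff_dvd]
    exact ⟨-g.1 0 1, by simp [g']⟩
  · simp only [g', fricke, act, ha, hγ, Matrix.of_apply, Matrix.cons_val', Matrix.cons_val_zero,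
      Matrix.cons_val_one, Matrix.cons_val_fin_one, mk.injEq]
    rw [Int.mul_ediv_cancel_left _ hp'.ne']
    refine ⟨by ring, by ring, ?_⟩
    refine Int.ediv_eq_of_eq_mul_right hp'.ne' ?_
    ring

theorem fricke_root {p : ℕ} (hp : 0 < p) {d β : ℤ} {Q : BQF} (h : Q.memN d p β) :
    (Q.fricke p).root = -1 / (p * Q.root) := by
  have hp' : (0 : ℝ) < p := by exact_mod_cast hp
  have hp'' : (p : ℂ) ≠ 0 := by exact_mod_cast hp.ne'
  have hr := h.1.1.root_mem
  have hr0 : Q.root ≠ 0 := fun h0 => by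
    rw [h0] at hr
    exact lt_irrefl (0 : ℝ) hr
  symm
  refine (h.fricke hp).1.1.eq_root ?_ ?_
  · have e : -1 / (p * Q.root) = ((p⁻¹ : ℝ) : ℂ) * -(Q.root)⁻¹ := by
      push_cast
      field_simp
    change 0 < (-1 / (p * Q.root)).im
    rw [e, Complex.im_ofReal_mul, Complex.neg_im, Complex.inv_im]
    have : 0 < Complex.normSq Q.root := Complex.normSq_pos.2 hr0
    have h2 : 0 < Q.root.im := hr
    rw [neg_div, neg_neg]
    positivity
  · have h0 := h.1.1.root_eq_zero
    obtain ⟨a, ha⟩ := h.2.1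
    simp only [fricke, ha]
    rw [Int.mul_ediv_cancel_left _ (by exact_mod_cast hp.ne')]
    rw [ha] at h0
    push_cast at h0 ⊢
    field_simp
    linear_combination h0

theorem sum_fricke_eq_sum_of_invariant {p : ℕ} (hp : p.Prime) {d β : ℤ}
    (hd : IsNegFundamental (-d))
    (hβ : β ^ 2 ≡ -d [ZMOD (4 * p)]) {Rp R1 : Finset BQF}
    (hRp : ∀ Q ∈ Rp, Q.memN d p β)
    (hRpineq : ∀ Q ∈ Rp, ∀ Q' ∈ Rp, Q ≠ Q' → ¬ equiv (CongruenceSubgroup.Gamma0 p) Q Q')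
    (hRpcover : ∀ Q : BQF, Q.memN d p β → ∃ Q' ∈ Rp, equiv (CongruenceSubgroup.Gamma0 p) Q Q')
    (hR1 : ∀ Q ∈ R1, Q.mem d)
    (hR1ineq : ∀ Q ∈ R1, ∀ Q' ∈ R1, Q ≠ Q' → ¬ equiv ⊤ Q Q')
    (hR1cover : ∀ Q : BQF, Q.mem d → ∃ Q' ∈ R1, equiv ⊤ Q Q') (f : BQF → ℂ)
    (hf : ∀ Q : BQF, Q.mem d → ∀ g, f (Q.act g) = f Q) :
    ∑ Q ∈ Rp, f (Q.fricke p) = ∑ Q ∈ R1, f Q := by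
  have hp0 := hp.pos
  have hinj : Set.InjOn (fricke p) Rp := fun Q hQ Q' hQ' h => by
    rw [← fricke_fricke hp0 (hRp Q hQ).2.1, h, fricke_fricke hp0 (hRp Q' hQ').2.1]
  rw [← Finset.sum_image hinj]
  refine sum_eq_sum_of_invariant hp hd (β := -β) (by rwa [neg_sq]) ?_ ?_ ?_ hR1 hR1ineq hR1cover f hf
  · intro Q hQ
    obtain ⟨Q, hmem, rfl⟩ := Finset.mem_image.1 hQ
    exact (hRp Q hmem).fricke hp0
  · intro Q hQ Q' hQ' hne
    obtain ⟨Q, hmem, rfl⟩ := Finset.mem_image.1 hQ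
    obtain ⟨Q', hmem', rfl⟩ := Finset.mem_image.1 hQ'
    rintro ⟨g, hg, he⟩
    obtain ⟨g', hg', he'⟩ := exists_fricke_act hp0 ((hRp Q hmem).fricke hp0).2.1 hg
    refine hRpineq Q hmem Q' hmem' (fun h => hne (h ▸ rfl)) ⟨g', hg', ?_⟩
    rw [he, fricke_fricke hp0 (hRp Q hmem).2.1, fricke_fricke hp0 (hRp Q' hmem').2.1] at he'
    exact he'.symm
  · intro Q hQ
    have hQ2 := hQ.fricke hp0
    rw [neg_neg] at hQ2
    obtain ⟨Q', hQ', g, hg, he⟩ := hRpcover _ hQ2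
    obtain ⟨g', hg', he'⟩ := exists_fricke_act hp0 hQ2.2.1 hg
    refine ⟨_, Finset.mem_image_of_mem _ hQ', g', hg', ?_⟩
    rw [← he, he', fricke_fricke hp0 hQ.2.1]

end BQF

section

open NumberTheorySymbols

theorem kronecker_eq_jacobiSym (a : ℤ) {q : ℕ} (hq : q.Prime) (hq2 : q ≠ 2) :
    kronecker a q = J(a | q) := by
  rw [kronecker, if_neg hq.ne_zero, hq.factorization, Finsupp.prod_single_index (by simp),
    if_neg hq2, pow_one]

theorem jacobiSym_eq_swap_of_emod_four_eq_one {E : ℤ} {n : ℕ} (hE : E % 4 = 1) (hn : Odd n) :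
    J(E | n) = J(n | E.natAbs) := by
  rcases Int.natAbs_eq E with h | h
  · conv_lhs => rw [h]
    exact jacobiSym.quadratic_reciprocity_one_mod_four (by omega) hn
  · conv_lhs => rw [h]
    have h3 : E.natAbs % 4 = 3 := by omega
    rw [jacobiSym.neg _ hn]
    rcases Nat.odd_mod_four_iff.1 (Nat.odd_iff.1 hn) with hn4 | hn4
    · rw [ZMod.χ₄_nat_one_mod_four hn4, one_mul]
      exact jacobiSym.quadratic_reciprocity_one_mod_four' (Nat.odd_iff.2 (by omega)) hn4
    · rw [ZMod.χ₄_nat_three_mod_four hn4, jacobiSym.quadratic_reciprocity_three_mod_four h3 hn4]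
      ring

theorem jacobiSym_eq_one_of_dvd_sq_sub {E s : ℤ} {b : ℕ} (h : (b : ℤ) ∣ s ^ 2 - E)
    (hE : IsCoprime E b) : J(E | b) = 1 := by
  have h1 : E % b = s ^ 2 % b := Int.modEq_iff_dvd.2 h
  rw [jacobiSym.mod_left' h1]
  refine jacobiSym.sq_one' ?_
  rw [← Int.isCoprime_iff_gcd_eq_one]
  obtain ⟨k, hk⟩ := h
  have h2 : IsCoprime (s ^ 2) (b : ℤ) := by
    rw [show s ^ 2 = E + b * k by linarith]
    exact hE.add_mul_left_left k
  exact (IsCoprime.pow_left_iff two_pos).1 h2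

theorem jacobiSym_eq_one_of_odd {E F X s : ℤ} {p n : ℕ} (hp : p.Prime) (hE : E % 4 = 1)
    (hpE : ¬ (p : ℤ) ∣ E) (hs : s ^ 2 ≡ E [ZMOD (4 * p)]) (hn : Odd n) (hnE : IsCoprime (n : ℤ) E)
    (h : 4 * p * n = X ^ 2 - E * F) : J(E | n) = 1 := by
  have hpE' : IsCoprime (p : ℤ) E :=
    ((Nat.prime_iff_prime_int.1 hp).coprime_iff_not_dvd).2 hpE
  have hEodd : Odd E.natAbs := Nat.odd_iff.2 (by omega)
  have h4 : IsCoprime (4 : ℤ) E := ⟨-(E / 4), 1, by omega⟩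
  have hall : J(4 * p * n | E.natAbs) = 1 := by
    refine jacobiSym_eq_one_of_dvd_sq_sub (s := X) (Int.natAbs_dvd.2 ⟨F, by linarith⟩) ?_
    have := (h4.mul_left hpE').mul_left hnE
    rw [Int.natCast_natAbs]
    exact this.abs_right
  have hpp : J(p | E.natAbs) = 1 := by
    rcases hp.eq_two_or_odd' with rfl | hodd
    · have h8 : E % 8 = 1 := by
        have h2 : s ^ 2 % 8 = E % 8 := hs
        rcases Int.even_or_odd' s with ⟨k, rfl | rfl⟩
        · exfalso
          ring_nf at h2
          omega
        · have := Int.even_mul_succ_self k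
          obtain ⟨r, hr⟩ := this
          have e : (2 * k + 1) ^ 2 = 8 * r + 1 := by linear_combination 4 * hr
          rw [e] at h2
          omega
      rw [Nat.cast_ofNat, jacobiSym.at_two hEodd, ZMod.χ₈_nat_eq_if_mod_eight]
      rw [if_neg (by omega), if_pos (by omega)]
    · rw [← jacobiSym_eq_swap_of_emod_four_eq_one hE hodd]
      refine jacobiSym_eq_one_of_dvd_sq_sub (s := s) ?_ hpE'.symm
      exact (dvd_mul_left _ _).trans (Int.modEq_iff_dvd.1 hs.symm)
  rw [jacobiSym.mul_left, jacobiSym.mul_left, hpp, jacobiSym.at_four hEodd, one_mul, one_mul] at hall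
  rw [jacobiSym_eq_swap_of_emod_four_eq_one hE hn, hall]

theorem jacobiSym_congr_right {a : ℤ} {b c : ℕ} (hb : Odd b) (hc : Odd c)
    (h : 4 * a ∣ (b : ℤ) - c) : J(a | b) = J(a | c) := by
  rw [jacobiSym.mod_right a hb, jacobiSym.mod_right a hc]
  congr 1
  refine (Int.natCast_modEq_iff.1 (Int.modEq_iff_dvd.2 ?_)).symm
  push_cast
  rcases abs_choice a with e | e <;> rw [e]
  · exact h
  · rwa [mul_neg, neg_dvd]

theorem exists_modEq_abs_lt_sq {m : ℤ} (hm : m ≠ 0) (X : ℤ) :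
    ∃ Z : ℤ, 4 * m ∣ Z - X ∧ |m| < Z ^ 2 := by
  by_cases h : |m| < X ^ 2
  · exact ⟨X, by simp, h⟩
  · refine ⟨X + 4 * m, by simp, ?_⟩
    push Not at h
    have h1 : X ^ 2 ≤ m ^ 2 := by
      have := Int.one_le_abs hm
      rw [← sq_abs m]
      nlinarith
    have h3 : |m| ≤ m ^ 2 := by
      rw [← sq_abs m]
      nlinarith [Int.one_le_abs hm]
    have h4 : 0 < m ^ 2 := by positivity
    nlinarith [sq_nonneg (X + m), sq_nonneg (X + 2 * m), sq_nonneg (X + 4 * m)]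

theorem jacobiSym_eq_one_of_eq_sq_sub {m X Y F : ℤ} {N : ℕ} (hm : m ≠ 0) (hN : Odd N)
    (hNm : IsCoprime (N : ℤ) m) (hF : F % 4 = 1) (h : N = X ^ 2 - m * F * Y ^ 2) :
    J(m | N) = 1 := by
  have hXm : IsCoprime X m := by
    refine (IsCoprime.pow_left_iff two_pos).1 (?_ : IsCoprime (X ^ 2) m)
    rw [show X ^ 2 = N + m * (F * Y ^ 2) by linarith]
    exact hNm.add_mul_left_left _
  have hNZ : Odd (N : ℤ) := by exact_mod_cast hN
  rcases Int.even_or_odd' Y with ⟨y, rfl | rfl⟩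
  · have hX : Odd X := by
      have : Odd (X ^ 2) := by
        rw [show X ^ 2 = N + 2 * (2 * m * F * y ^ 2) by linarith]
        exact hNZ.add_even (even_two_mul _)
      exact (Int.odd_pow' two_ne_zero).1 this
    have hX' : Odd X.natAbs := Int.natAbs_odd.2 hX
    rw [jacobiSym_congr_right (c := X.natAbs ^ 2) hN hX'.pow, jacobiSym.pow_right]
    · refine jacobiSym.sq_one ?_
      rw [← Int.isCoprime_iff_gcd_eq_one, Int.natCast_natAbs]
      exact hXm.symm.abs_right
    · refine ⟨-(F * y ^ 2), ?_⟩
      push_cast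
      rw [sq_abs, h]
      ring
  · obtain ⟨Z, ⟨w, hw⟩, hZ⟩ := exists_modEq_abs_lt_sq hm X
    obtain ⟨r, hr⟩ : ∃ r, F * (2 * y + 1) ^ 2 = 1 + 4 * r :=
      ⟨F / 4 * (2 * y + 1) ^ 2 + (y ^ 2 + y), by
        have : F = 4 * (F / 4) + 1 := by omega
        conv_lhs => rw [this]
        ring⟩
    obtain ⟨M, hM⟩ : ∃ M : ℕ, (M : ℤ) = Z ^ 2 - m :=
      ⟨(Z ^ 2 - m).toNat, Int.toNat_of_nonneg (by linarith [le_abs_self m])⟩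
    have hdvd : (N : ℤ) - M = 4 * m * (-r - w * (X + Z)) := by
      rw [h, hM, mul_assoc, hr]
      have : Z = X + 4 * m * w := by linarith
      rw [this]
      ring
    have hModd : Odd M := by
      have : Odd (M : ℤ) := by
        rw [show (M : ℤ) = N - 2 * (2 * m * (-r - w * (X + Z))) by linarith]
        exact hNZ.sub_even (even_two_mul _)
      exact_mod_cast this
    rw [jacobiSym_congr_right hN hModd ⟨_, hdvd⟩]
    refine jacobiSym_eq_one_of_dvd_sq_sub (s := Z) ⟨1, by rw [hM]; ring⟩ ?_
    have : IsCoprime Z m := by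
      rw [show Z = X + m * (4 * w) by linarith]
      exact hXm.add_mul_left_left _
    rw [hM, show Z ^ 2 - m = Z ^ 2 + m * -1 by ring]
    exact (this.pow_left.add_mul_left_left _).symm

theorem jacobiSym_eq_one_of_even {m F X Y s : ℤ} {p n : ℕ} (hp : p.Prime) (hp2 : p ≠ 2)
    (hm : m ≠ 0) (hpE : ¬ (p : ℤ) ∣ 4 * m) (hs : s ^ 2 ≡ 4 * m [ZMOD (4 * p)]) (hn : Odd n)
    (hnE : IsCoprime (n : ℤ) (4 * m)) (hF : F % 4 = 1)
    (h : 4 * p * n = X ^ 2 - 4 * m * F * Y ^ 2) : J(4 * m | n) = 1 := by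
  have hpE' : IsCoprime (p : ℤ) (4 * m) :=
    ((Nat.prime_iff_prime_int.1 hp).coprime_iff_not_dvd).2 hpE
  have hpodd : Odd p := hp.odd_of_ne_two hp2
  have hp1 : J(4 * m | p) = 1 :=
    jacobiSym_eq_one_of_dvd_sq_sub (s := s)
      ((dvd_mul_left _ _).trans (Int.modEq_iff_dvd.1 hs.symm)) hpE'.symm
  have hX : Even X := by
    have : Even (X ^ 2) := ⟨2 * (p * n + m * F * Y ^ 2), by linarith⟩
    exact (Int.even_pow' two_ne_zero).1 this
  obtain ⟨x, rfl⟩ := hX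
  have hpn : J(m | p * n) = 1 := by
    refine jacobiSym_eq_one_of_eq_sq_sub (X := x) (Y := Y) (F := F) hm (hpodd.mul hn) ?_ hF ?_
    · push_cast
      exact (hpE'.mul_left hnE).of_mul_right_right
    · push_cast
      linarith
  rw [jacobiSym.mul_right' _ hp.ne_zero hn.pos.ne'] at hpn
  rw [jacobiSym.mul_left, jacobiSym.at_four hpodd, one_mul] at hp1
  rw [jacobiSym.mul_left, jacobiSym.at_four hn, one_mul]
  rwa [hp1, one_mul] at hpn

theorem jacobiSym_eq_one_of_fundamental {E F X Y s : ℤ} {p n : ℕ} (hp : p.Prime)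
    (hE : IsFundamentalDiscriminant E) (hF : IsFundamentalDiscriminant F) (hEF : IsCoprime E F)
    (hpE : ¬ (p : ℤ) ∣ E) (hs : s ^ 2 ≡ E [ZMOD (4 * p)]) (hn : Odd n)
    (hnE : IsCoprime (n : ℤ) E) (h : 4 * p * n = X ^ 2 - E * F * Y ^ 2) : J(E | n) = 1 := by
  rcases hE.cases with ⟨hE4, -⟩ | ⟨m, rfl, hm, hm4⟩
  · exact jacobiSym_eq_one_of_odd (F := F * Y ^ 2) hp hE4 hpE hs hn hnE (by rw [h]; ring)
  · have hF4 : F % 4 = 1 := by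
      rcases hF.cases with ⟨hF4, -⟩ | ⟨r, rfl, -⟩
      · exact hF4
      · have h2 : IsUnit (4 : ℤ) := hEF.isUnit_of_dvd' ⟨m, rfl⟩ ⟨r, rfl⟩
        rw [Int.isUnit_iff] at h2
        omega
    refine jacobiSym_eq_one_of_even hp ?_ (by omega) hpE hs hn hnE hF4 h
    rintro rfl
    exact hpE ⟨2 * m, by push_cast; ring⟩

namespace BQF

theorem jacobiSym_disc_eq_one {Q : BQF} {q : ℕ} (hq : q.Prime) (hq2 : q ≠ 2)
    (h : Q.Represents q) (hqd : ¬ (q : ℤ) ∣ Q.disc) : J(Q.disc | q) = 1 := by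
  have hq' : Prime (q : ℤ) := Nat.prime_iff_prime_int.1 hq
  obtain ⟨x, y, hxy⟩ := h
  have key : ∀ A z : ℤ, ¬ (q : ℤ) ∣ z → (q : ℤ) ∣ A ^ 2 - Q.disc * z ^ 2 → J(Q.disc | q) = 1 := by
    intro A z hz hA
    have hz' : IsCoprime z q := (hq'.coprime_iff_not_dvd.2 hz).symm
    have h1 : J(Q.disc * z ^ 2 | q) = 1 :=
      jacobiSym_eq_one_of_dvd_sq_sub hA
        ((hq'.coprime_iff_not_dvd.2 hqd).symm.mul_left hz'.pow_left)
    rwa [jacobiSym.mul_left, jacobiSym.sq_one' (Int.isCoprime_iff_gcd_eq_one.1 hz'), mul_one] at h1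
  by_cases hy : (q : ℤ) ∣ y
  · refine key (2 * Q.c * y + Q.b * x) x (fun hx => ?_) ⟨4 * Q.c, ?_⟩
    · have h2 : (q : ℤ) * q ∣ q := by
        obtain ⟨u, rfl⟩ := hx
        obtain ⟨v, rfl⟩ := hy
        exact ⟨Q.a * u ^ 2 + Q.b * u * v + Q.c * v ^ 2, by
          conv_lhs => rw [← hxy]
          ring⟩
      have h3 : q * q ∣ q := by exact_mod_cast h2
      have h4 := Nat.le_of_dvd hq.pos h3
      nlinarith [hq.two_le]
    · rw [← hxy, disc]
      ring
  · refine key (2 * Q.a * x + Q.b * y) y hy ⟨4 * Q.a, ?_⟩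
    rw [← hxy, disc]
    ring

theorem exists_represents {Δ : ℤ} (h : IsNegFundamental Δ) {Q : BQF} (hQ : Q.disc = Δ)
    (ha : 0 < Q.a) (N : ℕ) : ∃ q : ℕ, q.Prime ∧ N < q ∧ Q.Represents q := by
  have := h.negFundamental hQ
  exact QuadOrder.exists_prime_represented Q.a Q.b Q.c ha N

theorem fricke_character_eq {p : ℕ} (hp : p.Prime) {D d β : ℤ} (hD1 : 1 < D) (hd : 0 < d)
    (hDfund : IsFundamentalDiscriminant D) (hdfund : IsFundamentalDiscriminant (-d))
    (hcop : IsCoprime D d) (hDsq : ∃ s : ℤ, s ^ 2 ≡ D [ZMOD (4 * p)])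
    (hdsq : ∃ s : ℤ, s ^ 2 ≡ -d [ZMOD (4 * p)]) {χ : BQF → ℤ}
    (hχ : ∀ Q : BQF, Q.mem (d * D) → ∀ q : ℕ, q.Prime → Q.Represents q →
      ¬ (q : ℤ) ∣ D * d → χ Q = kronecker D q)
    {Q : BQF} (hQ : Q.memN (d * D) p β) : χ (Q.fricke p) = χ Q := by
  have hΔ := isNegFundamental_mul hD1 hd hDfund hdfund hcop
  have hW := hQ.fricke hp.pos
  set N : ℕ := (D * d).natAbs + 2 with hN
  have hDd : 0 < D * d := by positivity
  have good : ∀ q : ℕ, q.Prime → N < q → IsCoprime (q : ℤ) D ∧ IsCoprime (q : ℤ) (-d) ∧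
      ¬ (q : ℤ) ∣ D * d ∧ q ≠ 2 := by
    intro q hq hlt
    have hnd : ¬ (q : ℤ) ∣ D * d := fun h => by
      have := Int.le_of_dvd hDd h
      omega
    have hc := (Nat.prime_iff_prime_int.1 hq).coprime_iff_not_dvd.2 hnd
    exact ⟨hc.of_mul_right_left, hc.of_mul_right_right.neg_right, hnd, by omega⟩
  obtain ⟨q₁, hq₁, hN₁, hr₁⟩ := exists_represents hΔ hQ.1.2 hQ.1.1.1 N
  obtain ⟨q₂, hq₂, hN₂, hr₂⟩ := exists_represents hΔ hW.1.2 hW.1.1.1 N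
  obtain ⟨hD₁, hd₁, hn₁, ho₁⟩ := good q₁ hq₁ hN₁
  obtain ⟨hD₂, hd₂, hn₂, ho₂⟩ := good q₂ hq₂ hN₂
  rw [hχ _ hQ.1 q₁ hq₁ hr₁ hn₁, hχ _ hW.1 q₂ hq₂ hr₂ hn₂, kronecker_eq_jacobiSym _ hq₁ ho₁,
    kronecker_eq_jacobiSym _ hq₂ ho₂]
  have hodd : Odd (q₁ * q₂) := (hq₁.odd_of_ne_two ho₁).mul (hq₂.odd_of_ne_two ho₂)
  obtain ⟨X, Y, hXY⟩ : ∃ X Y : ℤ, 4 * p * (q₁ * q₂ : ℕ) = X ^ 2 - D * (-d) * Y ^ 2 := by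
    obtain ⟨x, y, h₁⟩ := hr₁
    obtain ⟨u, v, h₂⟩ := hr₂
    obtain ⟨a, ha⟩ := hQ.2.1
    have hdisc : D * (-d) = Q.disc := by rw [hQ.1.2]; ring
    refine ⟨2 * Q.a * x * v + Q.b * (x * -(p * u) + y * v) + 2 * Q.c * y * -(p * u),
      x * -(p * u) - y * v, ?_⟩
    push_cast
    rw [hdisc, ← h₁, ← h₂, disc]
    simp only [fricke]
    rw [ha, Int.mul_ediv_cancel_left _ (by exact_mod_cast hp.ne_zero)]
    ring
  have h1 : J(D | q₁ * q₂) = 1 := by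
    by_cases hpD : (p : ℤ) ∣ D
    · have hpd : ¬ (p : ℤ) ∣ -d := fun h =>
        (Nat.prime_iff_prime_int.1 hp).not_isUnit (hcop.neg_right.isUnit_of_dvd' hpD h)
      obtain ⟨s, hs⟩ := hdsq
      have h2 : J(-d | q₁ * q₂) = 1 := by
        refine jacobiSym_eq_one_of_fundamental (X := X) (Y := Y) hp hdfund hDfund
          hcop.neg_right.symm hpd hs hodd ?_ (by rw [hXY]; ring)
        push_cast
        exact hd₁.mul_left hd₂
      have h3 : ∀ {q : ℕ} {P : BQF}, q.Prime → P.mem (d * D) → P.Represents q →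
          ¬ (q : ℤ) ∣ D * d → q ≠ 2 → J(D | q) * J(-d | q) = 1 := by
        intro q P hq hP hr hn ho
        have e : P.disc = D * -d := by rw [hP.2]; ring
        rw [← jacobiSym.mul_left, ← e]
        refine jacobiSym_disc_eq_one hq ho hr ?_
        rwa [e, mul_neg, dvd_neg]
      have h4 := h3 hq₁ hQ.1 hr₁ hn₁ ho₁
      have h5 := h3 hq₂ hW.1 hr₂ hn₂ ho₂
      rw [jacobiSym.mul_right' _ hq₁.ne_zero hq₂.ne_zero] at h2 ⊢
      calc J(D | q₁) * J(D | q₂) = J(D | q₁) * J(D | q₂) * (J(-d | q₁) * J(-d | q₂)) := by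
            rw [h2, mul_one]
        _ = (J(D | q₁) * J(-d | q₁)) * (J(D | q₂) * J(-d | q₂)) := by ring
        _ = 1 := by rw [h4, h5, one_mul]
    · obtain ⟨s, hs⟩ := hDsq
      refine jacobiSym_eq_one_of_fundamental (X := X) (Y := Y) hp hDfund hdfund
          hcop.neg_right hpD hs hodd ?_ hXY
      push_cast
      exact hD₁.mul_left hD₂
  rw [jacobiSym.mul_right' _ hq₁.ne_zero hq₂.ne_zero] at h1
  have h2 : J(D | q₁) ^ 2 = 1 := jacobiSym.sq_one (Int.isCoprime_iff_gcd_eq_one.1 hD₁.symm)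
  calc J(D | q₂) = J(D | q₁) ^ 2 * J(D | q₂) := by rw [h2, one_mul]
    _ = J(D | q₁) * (J(D | q₁) * J(D | q₂)) := by ring
    _ = J(D | q₁) := by rw [h1, mul_one]

end BQF

end

section

open Filter Topology

theorem isOpen_upperH : IsOpen UpperH := isOpen_lt continuous_const Complex.continuous_im

theorem convex_upperH : Convex ℝ UpperH := convex_halfSpace_im_gt 0

theorem norm_cexp_two_pi_mul_I_mul (r : ℝ) (τ : ℂ) :
    ‖Complex.exp (2 * Real.pi * Complex.I * r * τ)‖ = Real.exp (-(2 * Real.pi * r * τ.im)) := by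
  rw [Complex.norm_exp]
  congr 1
  simp [mul_assoc, Complex.mul_re, Complex.mul_im]

theorem HasPrincipalPart.exists_bound {m : ℕ} {g : ℂ → ℂ} (h : HasPrincipalPart m g)
    (hg : DifferentiableOn ℂ g UpperH) : ∃ C : ℝ, 0 ≤ C ∧ ∀ τ : ℂ, 1 ≤ τ.im →
      ‖g τ - Complex.exp (-(2 * Real.pi * Complex.I * m * τ))‖ ≤
        C * Real.exp (-(2 * Real.pi * τ.im)) := by
  obtain ⟨a, ha⟩ := h
  have hnorm : ∀ (n : ℕ) (τ : ℂ), ‖a n * Complex.exp (2 * Real.pi * Complex.I * (n + 1) * τ)‖ =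
      ‖a n‖ * Real.exp (-(2 * Real.pi * (n + 1) * τ.im)) := fun n τ => by
    have := norm_cexp_two_pi_mul_I_mul (n + 1) τ
    push_cast at this
    rw [norm_mul, this]
  by_cases hs : Summable fun n : ℕ => ‖a n‖ * Real.exp (-(2 * Real.pi * (n + 1)))
  · refine ⟨(∑' n : ℕ, ‖a n‖ * Real.exp (-(2 * Real.pi * (n + 1)))) * Real.exp (2 * Real.pi),
      mul_nonneg (tsum_nonneg fun n => by positivity) (by positivity), fun τ hτ => ?_⟩
    rw [ha τ (lt_of_lt_of_le one_pos hτ), add_sub_cancel_left, mul_assoc (tsum _), ← Real.exp_add,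
      ← tsum_mul_right]
    refine tsum_of_norm_bounded (hs.mul_right _).hasSum fun n => ?_
    rw [hnorm, mul_assoc ‖a n‖, ← Real.exp_add]
    refine mul_le_mul_of_nonneg_left (Real.exp_le_exp.2 ?_) (norm_nonneg _)
    have h1 : 0 ≤ 2 * Real.pi * n * (τ.im - 1) := by
      have : 0 ≤ τ.im - 1 := by linarith
      positivity
    linarith
  · refine ⟨0, le_rfl, fun τ hτ => ?_⟩
    have hsmall : ∀ z : ℂ, 0 < z.im → z.im < 1 →
        g z = Complex.exp (-(2 * Real.pi * Complex.I * m * z)) := by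
      intro z hz0 hz1
      rw [ha z hz0, tsum_eq_zero_of_not_summable, add_zero]
      intro hsum
      refine hs (Summable.of_nonneg_of_le (fun n => by positivity) (fun n => ?_) hsum.norm)
      rw [hnorm]
      refine mul_le_mul_of_nonneg_left (Real.exp_le_exp.2 ?_) (norm_nonneg _)
      have h1 : 0 ≤ 2 * Real.pi * (n + 1) * (1 - z.im) := by
        have : 0 ≤ 1 - z.im := by linarith
        positivity
      linarith
    have hI : (Complex.I / 2) ∈ UpperH := by
      change 0 < (Complex.I / 2).im
      norm_num
    have heq : g =ᶠ[𝓝 (Complex.I / 2)] fun z => Complex.exp (-(2 * Real.pi * Complex.I * m * z)) := by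
      have h1 : {z : ℂ | 0 < z.im ∧ z.im < 1} ∈ 𝓝 (Complex.I / 2) := by
        refine ((isOpen_lt continuous_const Complex.continuous_im).inter
          (isOpen_lt Complex.continuous_im continuous_const)).mem_nhds ?_
        constructor <;> simp <;> norm_num
      filter_upwards [h1] with z hz
      exact hsmall z hz.1 hz.2
    have key := (hg.analyticOnNhd isOpen_upperH).eqOn_of_preconnected_of_eventuallyEq
      (g := fun z => Complex.exp (-(2 * Real.pi * Complex.I * m * z)))
      ((Differentiable.differentiableOn (by fun_prop)).analyticOnNhd isOpen_upperH)
      convex_upperH.isPreconnected hI heq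
    rw [key (lt_of_lt_of_le one_pos hτ : τ ∈ UpperH)]
    simp

theorem moebiusZ_eq_smul_moebiusZ {p : ℕ} {γ : Matrix.SpecialLinearGroup (Fin 2) ℤ}
    (hγ : γ ∈ CongruenceSubgroup.Gamma0 p) (τ : ℂ) :
    ∃ γ' : Matrix.SpecialLinearGroup (Fin 2) ℤ, p * moebiusZ γ τ = moebiusZ γ' (p * τ) := by
  have hdet := BQF.det_eq γ
  rw [CongruenceSubgroup.Gamma0_mem, ZMod.intCast_zmod_eq_zero_iff_dvd] at hγ
  obtain ⟨c, hc⟩ := hγ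
  have hdet' : (!![γ.1 0 0, p * γ.1 0 1; c, γ.1 1 1] : Matrix _ _ ℤ).det = 1 := by
    rw [Matrix.det_fin_two_of]
    rw [hc] at hdet
    linarith
  let γ' : Matrix.SpecialLinearGroup (Fin 2) ℤ := ⟨_, hdet'⟩
  refine ⟨γ', ?_⟩
  simp only [moebiusZ, γ', hc, Matrix.of_apply, Matrix.cons_val', Matrix.cons_val_zero,
    Matrix.cons_val_one, Matrix.cons_val_fin_one]
  push_cast
  rw [← mul_div_assoc]
  congr 1 <;> ring

theorem natCast_mul_mem_upperH {p : ℕ} (hp : 0 < p) {τ : ℂ} (hτ : τ ∈ UpperH) :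
    (p : ℂ) * τ ∈ UpperH := by
  change 0 < ((p : ℂ) * τ).im
  have h1 : 0 < τ.im := hτ
  have h2 : (0 : ℝ) < p := by exact_mod_cast hp
  rw [← Complex.ofReal_natCast, Complex.im_ofReal_mul]
  positivity

theorem moebiusZ_modular_S (z : ℂ) : moebiusZ ModularGroup.S z = -1 / z := by
  simp [moebiusZ, ModularGroup.S]

theorem apply_neg_one_div {g : ℂ → ℂ} (hg : ∀ γ : Matrix.SpecialLinearGroup (Fin 2) ℤ,
    ∀ τ ∈ UpperH, g (moebiusZ γ τ) = g τ) {τ : ℂ} (hτ : τ ∈ UpperH) : g (-1 / τ) = g τ := by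
  rw [← moebiusZ_modular_S]
  exact hg _ τ hτ

theorem invariantGamma0Star_add_comp_mul {p : ℕ} (hp : 0 < p) {g : ℂ → ℂ}
    (hg : ∀ γ : Matrix.SpecialLinearGroup (Fin 2) ℤ, ∀ τ ∈ UpperH, g (moebiusZ γ τ) = g τ) :
    InvariantGamma0Star p fun τ => g (p * τ) + g τ := by
  have hp' : (p : ℂ) ≠ 0 := by exact_mod_cast hp.ne'
  refine ⟨fun γ hγ τ hτ => ?_, fun τ hτ => ?_⟩
  · obtain ⟨γ', h⟩ := moebiusZ_eq_smul_moebiusZ hγ τ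
    simp only [h]
    rw [hg _ _ hτ, hg _ _ (natCast_mul_mem_upperH hp hτ)]
  · simp only
    have h1 : (p : ℂ) * (-1 / (p * τ)) = -1 / τ := by
      field_simp
    rw [h1, apply_neg_one_div hg hτ, apply_neg_one_div hg (natCast_mul_mem_upperH hp hτ), add_comm]

theorem IsHauptmodulStar.eq_zero_of_bound {p : ℕ} {t : ℂ → ℂ} (ht : IsHauptmodulStar p t)
    {g : ℂ → ℂ} (hg : DifferentiableOn ℂ g UpperH) (hinv : InvariantGamma0Star p g) {C : ℝ}
    (hC : ∀ τ : ℂ, 1 ≤ τ.im → ‖g τ‖ ≤ C * Real.exp (-(2 * Real.pi * τ.im))) :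
    ∀ τ ∈ UpperH, g τ = 0 := by
  obtain ⟨htd, -, htp, huniv⟩ := ht
  obtain ⟨P, hP⟩ := huniv g hg hinv ⟨C, -1, fun τ _ h1 => (hC τ h1).trans_eq (by
    congr 2; ring)⟩
  have hexp : Tendsto (fun y : ℝ => Real.exp (-(2 * Real.pi * y))) atTop (𝓝 0) := by
    refine Real.tendsto_exp_neg_atTop_nhds_zero.comp ?_
    exact tendsto_id.const_mul_atTop (by positivity)
  have him : ∀ y : ℝ, (y * Complex.I).im = y := fun y => by simp
  have hg0 : Tendsto (fun y : ℝ => g (y * Complex.I)) atTop (𝓝 0) := by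
    refine squeeze_zero_norm' (a := fun y : ℝ => C * Real.exp (-(2 * Real.pi * y))) ?_ ?_
    · filter_upwards [eventually_ge_atTop 1] with y hy
      have := hC (y * Complex.I) (by rwa [him])
      rwa [him] at this
    · simpa using hexp.const_mul C
  have htop : Tendsto (fun y : ℝ => ‖t (y * Complex.I)‖) atTop atTop := by
    obtain ⟨C', hC'0, hC'⟩ := htp.exists_bound htd
    have h1 : Tendsto (fun y : ℝ => Real.exp (2 * Real.pi * y) - C') atTop atTop := by
      refine tendsto_atTop_add_const_right _ _ ?_
      exact Real.tendsto_exp_atTop.comp (tendsto_id.const_mul_atTop (by positivity))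
    refine tendsto_atTop_mono' _ ?_ h1
    filter_upwards [eventually_ge_atTop 1] with y hy
    have h2 := hC' (y * Complex.I) (by rwa [him])
    have h3 := norm_cexp_two_pi_mul_I_mul (-1) (y * Complex.I)
    rw [him] at h2 h3
    have h4 : Complex.exp (-(2 * Real.pi * Complex.I * (1 : ℕ) * (y * Complex.I))) =
        Complex.exp (2 * Real.pi * Complex.I * (-1 : ℝ) * (y * Complex.I)) := by
      congr 1
      push_cast
      ring
    rw [h4] at h2
    have h5 := norm_sub_norm_le (Complex.exp (2 * Real.pi * Complex.I * (-1 : ℝ) * (y * Complex.I)))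
      (t (y * Complex.I))
    rw [norm_sub_rev, h3] at h5
    have h6 : Real.exp (-(2 * Real.pi * y)) ≤ 1 := Real.exp_le_one_iff.2 (by
      have : 0 < y := by linarith
      have := Real.pi_pos
      have : 0 ≤ 2 * Real.pi * y := by positivity
      linarith)
    have h7 : Real.exp (-(2 * Real.pi * -1 * y)) = Real.exp (2 * Real.pi * y) := by congr 1; ring
    rw [h7] at h5
    nlinarith
  have hPg : ∀ᶠ y : ℝ in atTop, g (y * Complex.I) = P.eval (t (y * Complex.I)) := by
    filter_upwards [eventually_ge_atTop 1] with y hy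
    refine hP _ ?_
    change 0 < (y * Complex.I).im
    rw [him]
    linarith
  have hdeg : P.degree ≤ 0 := by
    by_contra! hdeg
    have h1 := P.tendsto_norm_atTop hdeg htop
    have h2 := (hg0.congr' hPg).norm
    exact not_tendsto_nhds_of_tendsto_atTop h1 _ h2
  rw [Polynomial.eq_C_of_degree_le_zero hdeg] at hP hPg
  simp only [Polynomial.eval_C] at hP hPg
  have h0 : P.coeff 0 = 0 := by
    have := hg0.congr' hPg
    exact tendsto_nhds_unique tendsto_const_nhds this
  intro τ hτ
  rw [hP τ hτ, h0]

/-- The expansion formula relating the level `p` and level one Hauptmodul polynomials. -/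
theorem IsHauptmodulStar.eval_mul_eq {p : ℕ} (hp : 0 < p) {t J : ℂ → ℂ}
    (ht : IsHauptmodulStar p t) (hJ : IsHauptmodulLevelOne J) {n : ℕ} {T S R : Polynomial ℂ}
    (hT : HasPrincipalPart (n * p) fun τ => T.eval (t τ))
    (hS : HasPrincipalPart n fun τ => S.eval (t τ))
    (hR : HasPrincipalPart n fun τ => R.eval (J τ)) {τ : ℂ} (hτ : τ ∈ UpperH) :
    T.eval (t τ) = R.eval (J (p * τ)) + R.eval (J τ) - S.eval (t τ) := by
  have hp1 : (1 : ℝ) ≤ p := by exact_mod_cast hp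
  have htd := ht.1
  have hJd := hJ.1
  have hTd := T.differentiable.comp_differentiableOn htd
  have hSd := S.differentiable.comp_differentiableOn htd
  have hRd := R.differentiable.comp_differentiableOn hJd
  have hpd : DifferentiableOn ℂ (fun τ : ℂ => R.eval (J (p * τ))) UpperH :=
    hRd.comp (f := fun τ : ℂ => p * τ) (by fun_prop) fun z hz => natCast_mul_mem_upperH hp hz
  obtain ⟨C₁, hC₁, b₁⟩ := hT.exists_bound hTd
  obtain ⟨C₂, hC₂, b₂⟩ := hS.exists_bound hSd
  obtain ⟨C₃, hC₃, b₃⟩ := hR.exists_bound hRd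
  have hinvJ := invariantGamma0Star_add_comp_mul hp (g := fun τ => R.eval (J τ))
    fun γ z hz => by rw [hJ.2.1 γ z hz]
  have key := ht.eq_zero_of_bound
    (g := fun τ => R.eval (J (p * τ)) + R.eval (J τ) - S.eval (t τ) - T.eval (t τ))
    (((hpd.add hRd).sub hSd).sub hTd) ?_ (C := C₁ + C₂ + 2 * C₃) ?_ τ hτ
  · linear_combination -key
  · refine ⟨fun γ hγ z hz => ?_, fun z hz => ?_⟩
    · have := hinvJ.1 γ hγ z hz
      simp only at this ⊢
      rw [this, ht.2.1.1 γ hγ z hz]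
    · have := hinvJ.2 z hz
      simp only at this ⊢
      rw [this, ht.2.1.2 z hz]
  · intro z hz
    have hpim : ((p : ℂ) * z).im = p * z.im := by
      rw [← Complex.ofReal_natCast, Complex.im_ofReal_mul]
    have hle : z.im ≤ p * z.im := by nlinarith
    have e₁ := b₁ z hz
    have e₂ := b₂ z hz
    have e₃ := b₃ z hz
    have e₄ := b₃ (p * z) (by rw [hpim]; linarith)
    have e₅ : C₃ * Real.exp (-(2 * Real.pi * ((p : ℂ) * z).im)) ≤
        C₃ * Real.exp (-(2 * Real.pi * z.im)) := by
      refine mul_le_mul_of_nonneg_left (Real.exp_le_exp.2 ?_) hC₃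
      rw [hpim]
      have := Real.pi_pos
      nlinarith
    have e₆ : Complex.exp (-(2 * Real.pi * Complex.I * (n * p : ℕ) * z)) =
        Complex.exp (-(2 * Real.pi * Complex.I * n * (p * z))) := by
      congr 1
      push_cast
      ring
    rw [e₆] at e₁
    set u := Complex.exp (-(2 * Real.pi * Complex.I * n * (p * z)))
    set v := Complex.exp (-(2 * Real.pi * Complex.I * n * z))
    calc _ = ‖((R.eval (J (p * z)) - u) + (R.eval (J z) - v) - (S.eval (t z) - v)) -
          (T.eval (t z) - u)‖ := by congr 1; ring
      _ ≤ ‖R.eval (J (p * z)) - u‖ + ‖R.eval (J z) - v‖ + ‖S.eval (t z) - v‖ +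
          ‖T.eval (t z) - u‖ :=
        (norm_sub_le _ _).trans (add_le_add_left ((norm_sub_le _ _).trans
          (add_le_add_left (norm_add_le _ _) _)) _)
      _ ≤ _ := by linarith

end

/-- **Recursion for twisted traces.**
Let `p` be a prime with `Γ₀(p)*` of genus zero (with Hauptmodul `t = j_p*`),
`D > 1` and `−d < 0` coprime fundamental discriminants congruent to squares mod
`4p`, `l` coprime to `p` and `k ≥ 0`.  With `t_m` (resp. `J_m`) the unique
polynomial in `t` (resp. in `J = j − 744`) with `q`-expansion `q^{−m} + O(q)`,
and `t^{(p)}_m(D,d) = ∑_{Q ∈ 𝒬_{dD,p,β}/Γ₀(p)} χ(Q) t_m(α_Q)` (and similarly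
`t^{(1)}_m(D,d)` over `𝒬_{dD}/SL₂(ℤ)` using `J_m`), one has
`t^{(p)}_{l p^{k+1}}(D,d) = 2 t^{(1)}_{l p^k}(D,d) − t^{(p)}_{l p^k}(D,d)`. -/
theorem twisted_trace_recursion (p : ℕ) (hp : p.Prime)
    (t : ℂ → ℂ) (ht : IsHauptmodulStar p t)
    (J : ℂ → ℂ) (hJ : IsHauptmodulLevelOne J)
    (tm Jm : ℕ → Polynomial ℂ)
    (htm : ∀ m : ℕ, 0 < m → HasPrincipalPart m (fun τ => (tm m).eval (t τ)))
    (hJm : ∀ m : ℕ, 0 < m → HasPrincipalPart m (fun τ => (Jm m).eval (J τ)))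
    (D d : ℤ) (hD1 : 1 < D) (hd : 0 < d)
    (hDfund : IsFundamentalDiscriminant D) (hdfund : IsFundamentalDiscriminant (-d))
    (hcop : IsCoprime D d)
    (hDsq : ∃ s : ℤ, s ^ 2 ≡ D [ZMOD (4 * p)])
    (hdsq : ∃ s : ℤ, s ^ 2 ≡ -d [ZMOD (4 * p)])
    (β : ℤ) (hβ : β ^ 2 ≡ -(d * D) [ZMOD (4 * p)])
    -- representatives of `𝒬_{dD,p,β}/Γ₀(p)`
    (Rp : Finset BQF)
    (hRp : ∀ Q ∈ Rp, Q.memN (d * D) p β)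
    (hRpineq : ∀ Q ∈ Rp, ∀ Q' ∈ Rp, Q ≠ Q' →
      ¬ BQF.equiv (CongruenceSubgroup.Gamma0 p) Q Q')
    (hRpcover : ∀ Q : BQF, Q.memN (d * D) p β →
      ∃ Q' ∈ Rp, BQF.equiv (CongruenceSubgroup.Gamma0 p) Q Q')
    -- representatives of `𝒬_{dD}/SL₂(ℤ)`
    (R1 : Finset BQF)
    (hR1 : ∀ Q ∈ R1, Q.mem (d * D))
    (hR1ineq : ∀ Q ∈ R1, ∀ Q' ∈ R1, Q ≠ Q' → ¬ BQF.equiv ⊤ Q Q')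
    (hR1cover : ∀ Q : BQF, Q.mem (d * D) → ∃ Q' ∈ R1, BQF.equiv ⊤ Q Q')
    -- the genus character `χ = χ_{D,−d}`
    (χ : BQF → ℤ)
    (hχpm : ∀ Q : BQF, Q.mem (d * D) → χ Q = 1 ∨ χ Q = -1)
    (hχ : ∀ Q : BQF, Q.mem (d * D) → ∀ q : ℕ, q.Prime → Q.Represents q →
      ¬ (q : ℤ) ∣ D * d → χ Q = kronecker D q)
    (hχinv : ∀ Q : BQF, Q.mem (d * D) → ∀ g : Matrix.SpecialLinearGroup (Fin 2) ℤ,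
      χ (Q.act g) = χ Q)
    (l : ℕ) (hl : Nat.Coprime l p) (hl0 : 0 < l) (k : ℕ) :
    (∑ Q ∈ Rp, (χ Q : ℂ) * (tm (l * p ^ (k + 1))).eval (t Q.root)) =
      2 * (∑ Q ∈ R1, (χ Q : ℂ) * (Jm (l * p ^ k)).eval (J Q.root)) -
        ∑ Q ∈ Rp, (χ Q : ℂ) * (tm (l * p ^ k)).eval (t Q.root) := by
  have hp0 := hp.pos
  have hΔ := isNegFundamental_mul hD1 hd hDfund hdfund hcop
  have hn : 0 < l * p ^ k := by positivity
  have hnp : l * p ^ (k + 1) = l * p ^ k * p := by rw [pow_succ, mul_assoc]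
  set f : BQF → ℂ := fun Q => (χ Q : ℂ) * (Jm (l * p ^ k)).eval (J Q.root) with hf
  have hfinv : ∀ Q : BQF, Q.mem (d * D) → ∀ g, f (Q.act g) = f Q := fun Q hQ g => by
    simp only [hf]
    rw [hχinv Q hQ g, ← hJ.2.1 g _ (hQ.1.act g).root_mem, BQF.moebiusZ_root_act hQ.1]
  have h1 := BQF.sum_eq_sum_of_invariant hp hΔ hβ hRp hRpineq hRpcover hR1 hR1ineq hR1cover f hfinv
  have h2 := BQF.sum_fricke_eq_sum_of_invariant hp hΔ hβ hRp hRpineq hRpcover hR1 hR1ineq hR1cover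
    f hfinv
  rw [two_mul]
  nth_rw 1 [← h2]
  rw [← h1, ← Finset.sum_add_distrib, ← Finset.sum_sub_distrib]
  refine Finset.sum_congr rfl fun Q hQ => ?_
  have hT := htm (l * p ^ (k + 1)) (by positivity)
  rw [hnp] at hT ⊢
  have hroot := (hRp Q hQ).1.1.root_mem
  simp only [hf]
  rw [ht.eval_mul_eq hp0 hJ hT (htm _ hn) (hJm _ hn) hroot,
    BQF.fricke_character_eq hp hD1 hd hDfund hdfund hcop hDsq hdsq hχ (hRp Q hQ),
    BQF.fricke_root hp0 (hRp Q hQ),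
    apply_neg_one_div hJ.2.1 (natCast_mul_mem_upperH hp0 hroot)]
  ring
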